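/- arXiv:math/0406165 — 2 statements merged into one kernel-verified Lean document; each statement's English description precedes it below -/
import Mathlib

section
/- Let (R,m) be a noetherian local ring, i ≥ 1, and x_1,…,x_i ∈ R. Then Ass_R(D(H^i_{(x_1,…,x_i)R}(R))) ⊆ { p ∈ Spec(R) : H^i_{(x_1,…,x_i)R}(R/p) ≠ 0 }. -/
open IsLocalRing

/-- The underlying `R`-module of the `i`-th local cohomology of the `R`-module `M`
with support in the ideal `I`. -/
noncomputable abbrev LocalCohomologyModule {R : Type} [CommRing R] (I : Ideal R) (i : ℕ)
    (M : Type) [AddCommGroup M] [Module R M] : ModuleCat R :=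
  (localCohomology I i).obj (ModuleCat.of R M)

/-- `E` is an injective hull of the residue field of the local ring `R`:
`E` is injective and admits an essential embedding of `R/m`. -/
def IsInjectiveHullOfResidueField (R : Type) [CommRing R] [IsLocalRing R]
    (E : Type) [AddCommGroup E] [Module R E] : Prop :=
  Module.Injective R E ∧
    ∃ f : ResidueField R →ₗ[R] E, Function.Injective f ∧
      ∀ N : Submodule R E, N ≠ ⊥ → N ⊓ LinearMap.range f ≠ ⊥

/-- Up to a power of `a`, a `J`-power torsion element of an injective module over a noetherian ring
is divisible by powers of `a` inside the `J`-power torsion. -/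
theorem Module.Injective.exists_pow_smul_eq_of_pow_torsion {R : Type} [CommRing R]
    [IsNoetherianRing R] {E : Type} [AddCommGroup E] [Module R E] [hE : Module.Injective R E]
    (J : Ideal R) (a : R) (s m : ℕ) (u : E) (hu : ∀ b ∈ J ^ m, b • u = 0) :
    ∃ (t n : ℕ) (v : E), a ^ (s + t) • v = a ^ t • u ∧ ∀ b ∈ J ^ n, b • v = 0 := by
  obtain ⟨t, ht⟩ := monotone_stabilizes_iff_noetherian.mpr (inferInstance : IsNoetherian R R)
    ⟨fun n => LinearMap.ker (LinearMap.mulRight R (a ^ n)), fun i j hij c hc => by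
      obtain ⟨k, rfl⟩ := Nat.exists_eq_add_of_le hij
      simp only [LinearMap.mem_ker, LinearMap.mulRight_apply] at hc ⊢
      rw [pow_add, ← mul_assoc, hc, zero_mul]⟩
  have hstab : ∀ c : R, c * a ^ (s + t) = 0 → c * a ^ t = 0 := fun c hc => by
    have h2 : c ∈ LinearMap.ker (LinearMap.mulRight R (a ^ t)) := (ht (s + t) (by omega)).ge hc
    exact h2
  obtain ⟨k, hk⟩ := Ideal.exists_pow_inf_eq_pow_smul J (Ideal.span {a ^ (s + t)} : Submodule R R)
  have hAR : ∀ c : R, c * a ^ (s + t) ∈ J ^ (m + k) → c • a ^ t • u = 0 := fun c hc => by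
    have h1 : c * a ^ (s + t) ∈ J ^ m • (Ideal.span {a ^ (s + t)} : Submodule R R) := by
      have h2 := hk (m + k) (by omega)
      rw [Nat.add_sub_cancel] at h2
      refine Submodule.smul_mono le_rfl inf_le_right (h2.le ⟨?_, ?_⟩)
      · rw [smul_eq_mul, Ideal.mul_top]
        exact hc
      · exact Ideal.mul_mem_left _ _ (Ideal.mem_span_singleton_self _)
    rw [smul_eq_mul, Ideal.mem_mul_span_singleton] at h1
    obtain ⟨b, hb, hbc⟩ := h1
    have h3 := hstab (c - b) (by rw [sub_mul, hbc, sub_self])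
    rw [sub_mul, sub_eq_zero] at h3
    rw [smul_smul, h3, mul_comm, mul_smul, hu b hb, smul_zero]
  let K : Submodule R R := Submodule.comap (LinearMap.mulRight R (a ^ (s + t))) (J ^ (m + k))
  obtain ⟨h, hh⟩ := hE.out
    (Submodule.mapQ K (J ^ (m + k)) (LinearMap.mulRight R (a ^ (s + t))) le_rfl)
    (by
      rw [← LinearMap.ker_eq_bot, Submodule.ker_mapQ, ← le_bot_iff, Submodule.map_le_iff_le_comap,
        Submodule.comap_bot, Submodule.ker_mkQ])
    (Submodule.liftQ K (LinearMap.toSpanSingleton R E (a ^ t • u)) fun c hc => hAR c hc)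
  refine ⟨t, m + k, h (Submodule.Quotient.mk 1), ?_, fun b hb => ?_⟩
  · have : h (Submodule.Quotient.mk (1 * a ^ (s + t))) = a ^ t • u :=
      (hh (Submodule.Quotient.mk 1)).trans (one_smul R _)
    rw [← this, ← map_smul, ← Submodule.Quotient.mk_smul, smul_eq_mul, mul_comm]
  · rw [← map_smul, ← Submodule.Quotient.mk_smul, smul_eq_mul, mul_one,
      (Submodule.Quotient.mk_eq_zero _).mpr hb, map_zero]

/-- If `J` is a sequence of injective modules that is exact in positive degrees, then the
`(x₁, …, xₙ)`-power torsion of `J` is exact in degrees larger than `n`. -/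
theorem exists_pow_torsion_preimage {R : Type} [CommRing R] [IsNoetherianRing R]
    (J : ℕ → Type) [∀ k, AddCommGroup (J k)] [∀ k, Module R (J k)] [∀ k, Module.Injective R (J k)]
    (d : ∀ k, J k →ₗ[R] J (k + 1)) (hd : ∀ k, Function.Exact (d k) (d (k + 1))) (n : ℕ) :
    ∀ (x : Fin n → R) (k : ℕ) (_ : n ≤ k) (z : J (k + 1)) (_ : d (k + 1) z = 0) (t : ℕ)
      (_ : ∀ b ∈ Ideal.span (Set.range x) ^ t, b • z = 0),
      ∃ (w : J k) (t' : ℕ), (∀ b ∈ Ideal.span (Set.range x) ^ t', b • w = 0) ∧ d k w = z := by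
  induction n with
  | zero =>
    intro x k _ z hz t _
    obtain ⟨w, hw⟩ := (hd k z).mp hz
    exact ⟨w, 1, fun b hb => by simp_all, hw⟩
  | succ n ih =>
    intro x k hk z hz t ht
    obtain ⟨k, rfl⟩ : ∃ l, k = l + 1 := ⟨k - 1, by omega⟩
    have hspan : Ideal.span (Set.range x) =
        Ideal.span (Set.range (Fin.tail x)) ⊔ Ideal.span {x 0} := by
      rw [← Ideal.span_union, Set.union_comm, Set.singleton_union, ← Fin.range_cons,
        Fin.cons_self_tail]
    set I := Ideal.span (Set.range (Fin.tail x)) with hI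
    have hle : I ≤ Ideal.span (Set.range x) := hspan ▸ le_sup_left
    obtain ⟨w, m, hw, rfl⟩ := ih (Fin.tail x) (k + 1) (by omega) z hz t
      fun b hb => ht b (Ideal.pow_right_mono hle t hb)
    have hx : x 0 ^ t • d (k + 1) w = 0 :=
      ht _ (Ideal.pow_mem_pow (Ideal.subset_span (Set.mem_range_self 0)) t)
    obtain ⟨u, m', hu, hdu⟩ := ih (Fin.tail x) k (by omega) (x 0 ^ t • w)
      (by rw [map_smul, hx]) m fun b hb => by rw [smul_comm, hw b hb, smul_zero]
    obtain ⟨l, m'', v, hv, hv'⟩ :=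
      Module.Injective.exists_pow_smul_eq_of_pow_torsion I (x 0) t m' u hu
    have hI' : ∀ b ∈ I ^ (m + m''), b • (w - d k v) = 0 := fun b hb => by
      rw [smul_sub, ← map_smul, hv' b (Ideal.pow_le_pow_right (by omega) hb),
        hw b (Ideal.pow_le_pow_right (by omega) hb), map_zero, sub_zero]
    have hx' : x 0 ^ (t + l) • (w - d k v) = 0 := by
      rw [smul_sub, ← map_smul, hv, map_smul, hdu, smul_smul, add_comm t l, pow_add, sub_self]
    refine ⟨w - d k v, m + m'' + (t + l), fun b hb => ?_, ?_⟩
    · rw [hspan] at hb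
      obtain ⟨b₁, h₁, b₂, h₂, rfl⟩ := Submodule.mem_sup.mp (Ideal.sup_pow_add_le_pow_sup_pow hb)
      rw [Ideal.span_singleton_pow, Ideal.mem_span_singleton'] at h₂
      obtain ⟨c, rfl⟩ := h₂
      rw [add_smul, hI' b₁ h₁, mul_smul, hx', smul_zero, add_zero]
    · rw [map_sub, (hd k).apply_apply_eq_zero, sub_zero]

section Cocycles

open CategoryTheory Opposite

variable {R : Type} [CommRing R]

namespace localCohomology

/-- The chosen projective resolution of `R ⧸ I ^ t`. -/
noncomputable abbrev powResolution (I : Ideal R) (t : ℕ) :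
    ProjectiveResolution ((ringModIdeals (idealPowersDiagram I)).obj (op t)) :=
  projectiveResolution _

/-- The chosen lift of the projection `R ⧸ I ^ t' → R ⧸ I ^ t` to projective resolutions. -/
noncomputable abbrev powResolutionMap (I : Ideal R) {t t' : ℕ} (h : t ≤ t') :
    (powResolution I t').complex ⟶ (powResolution I t).complex :=
  ProjectiveResolution.lift ((ringModIdeals (idealPowersDiagram I)).map (homOfLE h).op) _ _

/-- The augmentation of the chosen projective resolution of `R ⧸ I ^ t`. -/
noncomputable def powAugmentation (I : Ideal R) (t : ℕ) :
    (powResolution I t).complex.X 0 ⟶ (ringModIdeals (idealPowersDiagram I)).obj (op t) :=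
  (powResolution I t).π.f 0

instance (I : Ideal R) (t : ℕ) : Epi (powAugmentation I t) :=
  inferInstanceAs (Epi ((powResolution I t).π.f 0))

theorem d_comp_powAugmentation (I : Ideal R) (t : ℕ) :
    (powResolution I t).complex.d 1 0 ≫ powAugmentation I t = 0 :=
  (powResolution I t).complex_d_comp_π_f_zero

theorem exact_powAugmentation (I : Ideal R) (t : ℕ) :
    (ShortComplex.mk _ _ (d_comp_powAugmentation I t)).Exact :=
  (powResolution I t).exact₀

theorem powResolutionMap_comp_powAugmentation (I : Ideal R) {t t' : ℕ} (h : t ≤ t') :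
    (powResolutionMap I h).f 0 ≫ powAugmentation I t =
      powAugmentation I t' ≫ (ringModIdeals (idealPowersDiagram I)).map (homOfLE h).op :=
  ProjectiveResolution.lift_commutes_zero _ _ _

/-- Every cocycle of degree `m + 1` computing `Ext (R ⧸ I ^ t) M` becomes a coboundary over
`R ⧸ I ^ t'` for some `t' ≥ t`. -/
def CocyclesVanish (I : Ideal R) (m : ℕ) (M : ModuleCat R) : Prop :=
  ∀ (t : ℕ) (f : (powResolution I t).complex.X (m + 1) ⟶ M),
    (powResolution I t).complex.d (m + 2) (m + 1) ≫ f = 0 →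
    ∃ (t' : ℕ) (h : t ≤ t') (g : (powResolution I t').complex.X m ⟶ M),
      (powResolutionMap I h).f (m + 1) ≫ f = (powResolution I t').complex.d (m + 1) m ≫ g

theorem cocyclesVanish_succ (I : Ideal R) (m : ℕ) (S : ShortComplex (ModuleCat R))
    (hS : S.ShortExact) [Injective S.X₂] (h : CocyclesVanish I m S.X₃) :
    CocyclesVanish I (m + 1) S.X₁ := by
  intro t f hf
  have := hS.mono_f
  have := hS.epi_g
  have hfS : (powResolution I t).complex.d (m + 3) (m + 2) ≫ f ≫ S.f = 0 := by
    rw [← Category.assoc, hf, Limits.zero_comp]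
  let g := ((powResolution I t).exact_succ (m + 1)).descToInjective (f ≫ S.f) hfS
  have hg : (powResolution I t).complex.d (m + 2) (m + 1) ≫ g = f ≫ S.f :=
    ((powResolution I t).exact_succ (m + 1)).comp_descToInjective (f ≫ S.f) hfS
  obtain ⟨t', htt', u, hu⟩ := h t (g ≫ S.g) (by
    rw [← Category.assoc, hg, Category.assoc, S.zero, Limits.comp_zero])
  let v := Projective.factorThru u S.g
  have hv : v ≫ S.g = u := Projective.factorThru_comp u S.g
  have hk : ((powResolutionMap I htt').f (m + 1) ≫ g -
      (powResolution I t').complex.d (m + 1) m ≫ v) ≫ S.g = 0 := by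
    rw [Preadditive.sub_comp, Category.assoc, Category.assoc, hu, hv, sub_self]
  refine ⟨t', htt', hS.exact.lift _ hk, ?_⟩
  rw [← cancel_mono S.f, Category.assoc, Category.assoc, hS.exact.lift_f, Preadditive.comp_sub,
    HomologicalComplex.d_comp_d_assoc, Limits.zero_comp, sub_zero, ← hg,
    HomologicalComplex.Hom.comm_assoc]

theorem cocyclesVanish_zero (I : Ideal R) {M J₀ J₁ J₂ : ModuleCat R} (ι : M ⟶ J₀) [Mono ι]
    [Injective J₀] (d : J₀ ⟶ J₁) (d' : J₁ ⟶ J₂) (w : ι ≫ d = 0) (w' : d ≫ d' = 0)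
    (hex : (ShortComplex.mk ι d w).Exact)
    (htors : ∀ (t : ℕ) (g : (ringModIdeals (idealPowersDiagram I)).obj (op t) ⟶ J₁), g ≫ d' = 0 →
      ∃ (t' : ℕ) (h : t ≤ t') (g' : (ringModIdeals (idealPowersDiagram I)).obj (op t') ⟶ J₀),
        g' ≫ d = (ringModIdeals (idealPowersDiagram I)).map (homOfLE h).op ≫ g) :
    CocyclesVanish I 0 M := by
  intro t f hf
  have hfS : (powResolution I t).complex.d 2 1 ≫ f ≫ ι = 0 := by
    rw [← Category.assoc, hf, Limits.zero_comp]
  let g := ((powResolution I t).exact_succ 0).descToInjective (f ≫ ι) hfS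
  have hg : (powResolution I t).complex.d 1 0 ≫ g = f ≫ ι :=
    ((powResolution I t).exact_succ 0).comp_descToInjective (f ≫ ι) hfS
  have hgd : (powResolution I t).complex.d 1 0 ≫ g ≫ d = 0 := by
    rw [← Category.assoc, hg, Category.assoc, w, Limits.comp_zero]
  have : Epi (ShortComplex.mk _ _ (d_comp_powAugmentation I t)).g :=
    inferInstanceAs (Epi (powAugmentation I t))
  let gb : (ringModIdeals (idealPowersDiagram I)).obj (op t) ⟶ J₁ :=
    (exact_powAugmentation I t).desc (g ≫ d) hgd
  have hgb : powAugmentation I t ≫ gb = g ≫ d :=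
    (exact_powAugmentation I t).g_desc (g ≫ d) hgd
  obtain ⟨t', htt', g', hg'⟩ := htors t gb (by
    rw [← cancel_epi (powAugmentation I t), ← Category.assoc, hgb, Category.assoc, w',
      Limits.comp_zero, Limits.comp_zero])
  have hk : ((powResolutionMap I htt').f 0 ≫ g - powAugmentation I t' ≫ g') ≫ d = 0 := by
    rw [Preadditive.sub_comp, Category.assoc, ← hgb, Category.assoc, hg', sub_eq_zero,
      ← Category.assoc, powResolutionMap_comp_powAugmentation I htt', Category.assoc]
  have hlift : hex.lift _ hk ≫ ι = _ := hex.lift_f _ hk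
  refine ⟨t', htt', hex.lift _ hk, ?_⟩
  rw [← cancel_mono ι, Category.assoc, Category.assoc, hlift, Preadditive.comp_sub,
    ← Category.assoc _ (powAugmentation I t'), d_comp_powAugmentation I t',
    Limits.zero_comp, sub_zero, ← hg,
    HomologicalComplex.Hom.comm_assoc]

theorem cocyclesVanish_of_pow_torsion (I : Ideal R) (m : ℕ) :
    ∀ (J : ℕ → Type) [∀ k, AddCommGroup (J k)] [∀ k, Module R (J k)]
      [∀ k, Module.Injective R (J k)]
      (d : ∀ k, J k →ₗ[R] J (k + 1)) (_ : ∀ k, Function.Exact (d k) (d (k + 1)))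
      (_ : ∀ (z : J (m + 1)) (_ : d (m + 1) z = 0) (t : ℕ) (_ : ∀ b ∈ I ^ t, b • z = 0),
        ∃ (w : J m) (t' : ℕ), (∀ b ∈ I ^ t', b • w = 0) ∧ d m w = z)
      (M : ModuleCat R) (ι : M →ₗ[R] J 0) (_ : Function.Injective ι)
      (_ : Function.Exact ι (d 0)), CocyclesVanish I m M := by
  induction m with
  | zero =>
    intro J _ _ _ d hd htors M ι hι hex
    have : Mono (ModuleCat.ofHom ι) := (ModuleCat.mono_iff_injective _).mpr hι
    have : Injective (ModuleCat.of R (J 0)) := Module.injective_object_of_injective_module R (J 0)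
    refine cocyclesVanish_zero I (ModuleCat.ofHom ι) (ModuleCat.ofHom (d 0))
      (ModuleCat.ofHom (d 1)) (by ext y; exact hex.apply_apply_eq_zero y)
      (by ext y; exact (hd 0).apply_apply_eq_zero y)
      ((ShortComplex.ShortExact.moduleCat_exact_iff_function_exact _).mpr hex) ?_
    intro t g hg
    let g₁ : (R ⧸ I ^ t) →ₗ[R] J 1 := g.hom
    have hz : ∀ b ∈ I ^ t, b • g₁ (Submodule.Quotient.mk 1) = 0 := fun b hb => by
      rw [← map_smul, ← Submodule.Quotient.mk_smul, smul_eq_mul, mul_one,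
        (Submodule.Quotient.mk_eq_zero (I ^ t)).mpr hb, map_zero]
    obtain ⟨w, t', hw, hdw⟩ := htors (g₁ (Submodule.Quotient.mk 1))
      (ConcreteCategory.congr_hom hg _) t hz
    refine ⟨max t t', le_max_left _ _, ModuleCat.ofHom (Submodule.liftQ (I ^ (max t t'))
      (LinearMap.toSpanSingleton R (J 0) w)
      fun b hb => hw b (Ideal.pow_le_pow_right (le_max_right t t') hb)), ?_⟩
    refine ModuleCat.hom_ext (Submodule.linearMap_qext _ (LinearMap.ext_ring ?_))
    change d 0 ((1 : R) • w) = g₁ (Submodule.Quotient.mk 1)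
    rw [one_smul, hdw]
  | succ m ih =>
    intro J _ _ _ d hd htors M ι hι hex
    have : Injective (ModuleCat.of R (J 0)) := Module.injective_object_of_injective_module R (J 0)
    let q : J 0 →ₗ[R] LinearMap.ker (d 1) :=
      (d 0).codRestrict _ fun y => (hd 0).apply_apply_eq_zero y
    have hq : Function.Surjective q := fun ⟨y, hy⟩ => by
      obtain ⟨u, rfl⟩ := (hd 0 y).mp hy
      exact ⟨u, rfl⟩
    have hιq : Function.Exact ι q := fun y => by
      rw [← hex y, Subtype.ext_iff]; rfl
    let S : ShortComplex (ModuleCat R) := ShortComplex.mk (ModuleCat.ofHom ι) (ModuleCat.ofHom q)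
      (by ext y : 2; exact hιq.apply_apply_eq_zero y)
    have hS : S.ShortExact :=
      { exact := (ShortComplex.ShortExact.moduleCat_exact_iff_function_exact _).mpr hιq
        mono_f := (ModuleCat.mono_iff_injective _).mpr hι
        epi_g := (ModuleCat.epi_iff_surjective _).mpr hq }
    have : Injective S.X₂ := this
    refine cocyclesVanish_succ I m S hS (ih (fun k => J (k + 1)) (fun k => d (k + 1))
      (fun k => hd (k + 1)) htors _ (LinearMap.ker (d 1)).subtype Subtype.val_injective ?_)
    exact LinearMap.exact_subtype_ker_map (d 1)

theorem cocyclesVanish_span_range [IsNoetherianRing R] {n : ℕ} (x : Fin n → R) (M : ModuleCat R) :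
    CocyclesVanish (Ideal.span (Set.range x)) n M := by
  let Q : InjectiveResolution M := injectiveResolution M
  have hinj (k : ℕ) : Module.Injective R (Q.cocomplex.X k) :=
    (Module.injective_iff_injective_object R _).mpr (Q.injective k)
  have hd (k : ℕ) : Function.Exact (Q.cocomplex.d k (k + 1)).hom
      (Q.cocomplex.d (k + 1) (k + 2)).hom :=
    (ShortComplex.ShortExact.moduleCat_exact_iff_function_exact _).mp (Q.exact_succ k)
  refine cocyclesVanish_of_pow_torsion _ n (fun k => Q.cocomplex.X k)
    (fun k => (Q.cocomplex.d k (k + 1)).hom) hd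
    (exists_pow_torsion_preimage _ _ hd n x n le_rfl) M (Q.ι.f 0).hom
    ((ModuleCat.mono_iff_injective _).mp inferInstance)
    ((ShortComplex.ShortExact.moduleCat_exact_iff_function_exact _).mp Q.exact₀)

end localCohomology

end Cocycles

section ExtRepresentatives

open CategoryTheory Opposite

variable {R : Type} [CommRing R]

namespace CategoryTheory.ProjectiveResolution

variable {X X' : ModuleCat R} (P : ProjectiveResolution X) (P' : ProjectiveResolution X')
  (Y : ModuleCat R) (n : ℕ)

/-- The complex `Hom(P, Y)`, as a chain complex in the opposite category of `R`-modules. -/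
noncomputable abbrev homComplex : ChainComplex (ModuleCat R)ᵒᵖ ℕ :=
  (((linearYoneda R (ModuleCat R)).obj Y).rightOp.mapHomologicalComplex _).obj P.complex

/-- The module of `n`-cocycles of `Hom(P, Y)`. -/
noncomputable abbrev extCocycles : ModuleCat R := ((P.homComplex Y).opcycles n).unop

/-- The morphism underlying a cocycle. -/
noncomputable def extCocyclesι : P.extCocycles Y n →ₗ[R] (P.complex.X n ⟶ Y) :=
  ((P.homComplex Y).pOpcycles n).unop.hom

/-- The identification of `Ext`, in the opposite category, with the homology of `Hom(P, Y)`. -/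
noncomputable def extIsoHomology :
    (((linearYoneda R (ModuleCat R)).obj Y).rightOp.leftDerived n).obj X ≅
      (P.homComplex Y).homology n :=
  P.isoLeftDerivedObj _ n

/-- The class of a cocycle in `Ext`. -/
noncomputable def extClass :
    P.extCocycles Y n →ₗ[R] ((Ext R (ModuleCat R) n).obj (op X)).obj Y :=
  ((P.extIsoHomology Y n).hom ≫ (P.homComplex Y).homologyι n).unop.hom

theorem extCocyclesι_injective : Function.Injective (P.extCocyclesι Y n) :=
  (ModuleCat.mono_iff_injective ((P.homComplex Y).pOpcycles n).unop).mp inferInstance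

theorem extClass_surjective : Function.Surjective (P.extClass Y n) :=
  (ModuleCat.epi_iff_surjective
    ((P.extIsoHomology Y n).hom ≫ (P.homComplex Y).homologyι n).unop).mp inferInstance

theorem d_comp_extCocyclesι (c : P.extCocycles Y n) :
    P.complex.d (n + 1) n ≫ P.extCocyclesι Y n c = 0 := by
  have h := congr_arg Quiver.Hom.unop ((P.homComplex Y).d_pOpcycles (n + 1) n)
  exact ConcreteCategory.congr_hom h c

theorem exists_extCocyclesι_eq (f : P.complex.X n ⟶ Y) (hf : P.complex.d (n + 1) n ≫ f = 0) :
    ∃ c, P.extCocyclesι Y n c = f := by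
  have h : (ShortComplex.mk _ _ ((P.homComplex Y).d_pOpcycles (n + 1) n)).Exact :=
    ShortComplex.exact_of_g_is_cokernel _
      ((P.homComplex Y).opcyclesIsCokernel (n + 1) n (by simp))
  exact (ShortComplex.moduleCat_exact_iff _).mp h.unop f hf

theorem exists_eq_d_comp_of_extClass_eq_zero (m : ℕ) (c : P.extCocycles Y (m + 1))
    (hc : P.extClass Y (m + 1) c = 0) :
    ∃ g, P.extCocyclesι Y (m + 1) c = P.complex.d (m + 1) m ≫ g := by
  have h : (ShortComplex.mk _ _ ((P.homComplex Y).homologyι_comp_fromOpcycles (m + 1) m)).Exact :=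
    ShortComplex.exact_of_f_is_kernel _
      ((P.homComplex Y).homologyIsKernel (m + 1) m (by simp))
  have hc' : ((P.homComplex Y).homologyι (m + 1)).unop.hom c = 0 := by
    have : Function.Injective (P.extIsoHomology Y (m + 1)).hom.unop.hom :=
      (ModuleCat.mono_iff_injective _).mp inferInstance
    exact this (hc.trans (map_zero _).symm)
  obtain ⟨g, hg⟩ := (ShortComplex.moduleCat_exact_iff _).mp h.unop c hc'
  refine ⟨g, ?_⟩
  rw [← hg]
  exact ConcreteCategory.congr_hom
    (congr_arg Quiver.Hom.unop ((P.homComplex Y).p_fromOpcycles (m + 1) m)) g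

theorem extClass_eq_zero (m : ℕ) (c : P.extCocycles Y (m + 1)) (g : P.complex.X m ⟶ Y)
    (hc : P.extCocyclesι Y (m + 1) c = P.complex.d (m + 1) m ≫ g) :
    P.extClass Y (m + 1) c = 0 := by
  have h : c = ((P.homComplex Y).fromOpcycles (m + 1) m).unop.hom g := by
    refine P.extCocyclesι_injective Y _ (hc.trans ?_)
    exact (ConcreteCategory.congr_hom
      (congr_arg Quiver.Hom.unop ((P.homComplex Y).p_fromOpcycles (m + 1) m)) g).symm
  have h' := ConcreteCategory.congr_hom
    (congr_arg Quiver.Hom.unop ((P.homComplex Y).homologyι_comp_fromOpcycles (m + 1) m)) g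
  rw [h]
  exact (congr_arg (P.extIsoHomology Y (m + 1)).hom.unop.hom h').trans (map_zero _)

variable {P P'}

theorem exists_extClass_eq_map (a : X' ⟶ X) (φ : P'.complex ⟶ P.complex)
    (comm : φ.f 0 ≫ P.π.f 0 = P'.π.f 0 ≫ a) (c : P.extCocycles Y n) :
    ∃ c', P'.extCocyclesι Y n c' = φ.f n ≫ P.extCocyclesι Y n c ∧
      P'.extClass Y n c' = (((Ext R (ModuleCat R) n).map a.op).app Y).hom (P.extClass Y n c) := by
  let F := ((linearYoneda R (ModuleCat R)).obj Y).rightOp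
  let ψ := (F.mapHomologicalComplex _).map φ
  refine ⟨(HomologicalComplex.opcyclesMap ψ n).unop.hom c, ?_, ?_⟩
  · exact ConcreteCategory.congr_hom
      (congr_arg Quiver.Hom.unop (HomologicalComplex.p_opcyclesMap ψ n)) c
  · have h : (F.leftDerived n).map a ≫ (P.extIsoHomology Y n).hom =
        (P'.extIsoHomology Y n).hom ≫ HomologicalComplex.homologyMap ψ n :=
      isoLeftDerivedObj_hom_naturality a P' P φ comm F n
    have h' : ((P'.extIsoHomology Y n).hom ≫ (P'.homComplex Y).homologyι n) ≫
        HomologicalComplex.opcyclesMap ψ n =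
        (F.leftDerived n).map a ≫ (P.extIsoHomology Y n).hom ≫ (P.homComplex Y).homologyι n := by
      rw [← Category.assoc _ (P.extIsoHomology Y n).hom, h, Category.assoc, Category.assoc,
        HomologicalComplex.homologyι_naturality]
    exact ConcreteCategory.congr_hom (congr_arg Quiver.Hom.unop h') c

end CategoryTheory.ProjectiveResolution

end ExtRepresentatives

section ClassOfCocycle

open CategoryTheory Opposite Limits

variable {R : Type} [CommRing R]

namespace localCohomology

variable (I : Ideal R) (Y : ModuleCat R) (n : ℕ)

/-- The class in local cohomology of a cocycle computing `Ext (R ⧸ I ^ t) Y`. -/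
noncomputable def cocycleClass (t : ℕ) :
    (powResolution I t).extCocycles Y n →ₗ[R] (localCohomology I n).obj Y :=
  ((colimit.ι (diagram (idealPowersDiagram I) n) (op (op t))).app Y).hom ∘ₗ
    (powResolution I t).extClass Y n

/-- The colimit cocone defining local cohomology, evaluated at a module, is a colimit. -/
noncomputable def isColimitEvaluation :
    IsColimit (((evaluation _ _).obj Y).mapCocone
      (colimit.cocone (diagram (idealPowersDiagram I) n))) :=
  isColimitOfPreserves _ (colimit.isColimit _)

theorem exists_cocycleClass_eq (h : (localCohomology I n).obj Y) :
    ∃ t c, cocycleClass I Y n t c = h := by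
  obtain ⟨t, y, hy⟩ := Concrete.isColimit_exists_rep _ (isColimitEvaluation I Y n) h
  obtain ⟨c, hc⟩ := (powResolution I t.unop.unop).extClass_surjective Y n y
  refine ⟨t.unop.unop, c, ?_⟩
  rw [← hy, ← hc]
  rfl

theorem exists_cocycle_of_le {t t' : ℕ} (h : t ≤ t') (c : (powResolution I t).extCocycles Y n) :
    ∃ c', (powResolution I t').extCocyclesι Y n c' =
        (powResolutionMap I h).f n ≫ (powResolution I t).extCocyclesι Y n c ∧
      (powResolution I t').extClass Y n c' =
        (((diagram (idealPowersDiagram I) n).map (homOfLE h).op.op).app Y).hom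
          ((powResolution I t).extClass Y n c) :=
  ProjectiveResolution.exists_extClass_eq_map Y n _ (powResolutionMap I h)
    (powResolutionMap_comp_powAugmentation I h) c

theorem exists_cocycleClass_eq_of_le {t t' : ℕ} (h : t ≤ t')
    (c : (powResolution I t).extCocycles Y n) :
    ∃ c', (powResolution I t').extCocyclesι Y n c' =
        (powResolutionMap I h).f n ≫ (powResolution I t).extCocyclesι Y n c ∧
      cocycleClass I Y n t' c' = cocycleClass I Y n t c := by
  obtain ⟨c', hc', hcl⟩ := exists_cocycle_of_le I Y n h c
  refine ⟨c', hc', ?_⟩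
  have hw := congr_arg (fun α => α.app Y)
    (colimit.w (diagram (idealPowersDiagram I) n) (homOfLE h).op.op)
  have := ConcreteCategory.congr_hom hw ((powResolution I t).extClass Y n c)
  exact (congr_arg ((colimit.ι (diagram (idealPowersDiagram I) n) (op (op t'))).app Y).hom
    hcl).trans this

theorem exists_powResolutionMap_comp_eq (m t : ℕ) (c : (powResolution I t).extCocycles Y (m + 1))
    (hc : cocycleClass I Y (m + 1) t c = 0) :
    ∃ (t' : ℕ) (h : t ≤ t') (g : (powResolution I t').complex.X m ⟶ Y),
      (powResolutionMap I h).f (m + 1) ≫ (powResolution I t).extCocyclesι Y (m + 1) c =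
        (powResolution I t').complex.d (m + 1) m ≫ g := by
  obtain ⟨s, a, b, hab⟩ := Concrete.isColimit_exists_of_rep_eq _
    (isColimitEvaluation I Y (m + 1)) (i := op (op t)) (j := op (op t))
    ((powResolution I t).extClass Y (m + 1) c) 0 (hc.trans (map_zero _).symm)
  have h : t ≤ s.unop.unop := leOfHom a.unop.unop
  obtain ⟨c', hc', hcl⟩ := exists_cocycle_of_le I Y (m + 1) h c
  obtain ⟨g, hg⟩ := (powResolution I s.unop.unop).exists_eq_d_comp_of_extClass_eq_zero Y m c'
    (hcl.trans (hab.trans (map_zero _)))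
  exact ⟨_, h, g, hc'.symm.trans hg⟩

theorem cocycleClass_eq_of_eq_add_d_comp (m t : ℕ)
    (c c' : (powResolution I t).extCocycles Y (m + 1)) (g : (powResolution I t).complex.X m ⟶ Y)
    (h : (powResolution I t).extCocyclesι Y (m + 1) c =
      (powResolution I t).extCocyclesι Y (m + 1) c' + (powResolution I t).complex.d (m + 1) m ≫ g) :
    cocycleClass I Y (m + 1) t c = cocycleClass I Y (m + 1) t c' := by
  rw [← sub_eq_zero, ← map_sub]
  have := (powResolution I t).extClass_eq_zero Y m (c - c') g (by rw [map_sub, h]; abel)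
  exact (congr_arg ((colimit.ι (diagram (idealPowersDiagram I) (m + 1)) (op (op t))).app Y).hom
    this).trans (map_zero _)

end localCohomology

end ClassOfCocycle

section TopDegree

open CategoryTheory Opposite Limits

variable {R : Type} [CommRing R]

namespace localCohomology

theorem exists_cocycle_lift (I : Ideal R) (n : ℕ) (hI : ∀ M, CocyclesVanish I n M)
    {S : ShortComplex (ModuleCat R)} (hS : S.Exact) (t : ℕ)
    (k : (powResolution I t).complex.X n ⟶ S.X₂)
    (hk : (powResolution I t).complex.d (n + 1) n ≫ k = 0) (hkg : k ≫ S.g = 0) :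
    ∃ (t' : ℕ) (h : t ≤ t') (w : (powResolution I t').complex.X n ⟶ S.X₁),
      (powResolution I t').complex.d (n + 1) n ≫ w = 0 ∧
        w ≫ S.f = (powResolutionMap I h).f n ≫ k := by
  let q := hS.liftFromProjective k hkg
  have hq : q ≫ S.f = k := hS.liftFromProjective_comp k hkg
  let u := kernel.lift S.f ((powResolution I t).complex.d (n + 1) n ≫ q)
    (by rw [Category.assoc, hq, hk])
  have hu : u ≫ kernel.ι S.f = (powResolution I t).complex.d (n + 1) n ≫ q := kernel.lift_ι _ _ _
  obtain ⟨t', htt', v, hv⟩ := hI _ t u (by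
    rw [← cancel_mono (kernel.ι S.f), Category.assoc, hu, HomologicalComplex.d_comp_d_assoc,
      zero_comp, zero_comp])
  refine ⟨t', htt', (powResolutionMap I htt').f n ≫ q - v ≫ kernel.ι S.f, ?_, ?_⟩
  · rw [Preadditive.comp_sub, ← Category.assoc _ v, ← hv, Category.assoc, hu,
      HomologicalComplex.Hom.comm_assoc, sub_self]
  · rw [Preadditive.sub_comp, Category.assoc, Category.assoc, hq, kernel.condition, comp_zero,
      sub_zero]

theorem mem_smul_top_of_subsingleton [IsNoetherianRing R] (I : Ideal R) (m : ℕ)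
    (hI : ∀ M, CocyclesVanish I (m + 1) M) (p : Ideal R)
    (hp : Subsingleton ((localCohomology I (m + 1)).obj (ModuleCat.of R (R ⧸ p))))
    (h : (localCohomology I (m + 1)).obj (ModuleCat.of R R)) :
    h ∈ p • (⊤ : Submodule R ((localCohomology I (m + 1)).obj (ModuleCat.of R R))) := by
  obtain ⟨r, a, ha⟩ := Submodule.fg_iff_exists_fin_generating_family.mp (IsNoetherian.noetherian p)
  let π : ModuleCat.of R R ⟶ ModuleCat.of R (R ⧸ p) := ModuleCat.ofHom p.mkQ
  have : Epi π := (ModuleCat.epi_iff_surjective _).mpr p.mkQ_surjective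
  let e (k : Fin r) : ModuleCat.of R (Fin r → R) ⟶ ModuleCat.of R R :=
    ModuleCat.ofHom (LinearMap.proj k)
  let α : ModuleCat.of R (Fin r → R) ⟶ ModuleCat.of R R :=
    ModuleCat.ofHom (Fintype.linearCombination R a)
  have hα : α = ∑ k, a k • e k := by
    ext : 1
    refine LinearMap.ext fun y => ?_
    simp [α, e, ModuleCat.hom_sum, Fintype.linearCombination_apply, mul_comm]
  have hrange : LinearMap.range (Fintype.linearCombination R a) = p :=
    (Fintype.range_linearCombination R a).trans ha
  have hex : Function.Exact (Fintype.linearCombination R a) p.mkQ := by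
    rw [LinearMap.exact_iff, Submodule.ker_mkQ, hrange]
  have hzero : α ≫ π = 0 := by ext : 1; exact hex.linearMap_comp_eq_zero
  have hS : (ShortComplex.mk α π hzero).Exact :=
    (ShortComplex.ShortExact.moduleCat_exact_iff_function_exact _).mpr hex
  obtain ⟨t, c, hc⟩ := exists_cocycleClass_eq I (ModuleCat.of R R) (m + 1) h
  have hd := (powResolution I t).d_comp_extCocyclesι _ _ c
  obtain ⟨b, hb⟩ := (powResolution I t).exists_extCocyclesι_eq (ModuleCat.of R (R ⧸ p)) (m + 1)
    ((powResolution I t).extCocyclesι _ _ c ≫ π) (by rw [← Category.assoc, hd, zero_comp])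
  obtain ⟨t', htt', g, hg⟩ := exists_powResolutionMap_comp_eq I _ m t b (Subsingleton.elim _ _)
  let g' := Projective.factorThru g π
  have hg' : g' ≫ π = g := Projective.factorThru_comp g π
  obtain ⟨c', hc', hcl⟩ := exists_cocycleClass_eq_of_le I _ _ htt' c
  rw [← hc, ← hcl]
  have hd' := (powResolution I t').d_comp_extCocyclesι _ _ c'
  obtain ⟨c₁, hc₁⟩ := (powResolution I t').exists_extCocyclesι_eq (ModuleCat.of R R) (m + 1)
    ((powResolution I t').extCocyclesι _ _ c' - (powResolution I t').complex.d (m + 1) m ≫ g')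
    (by rw [Preadditive.comp_sub, hd', HomologicalComplex.d_comp_d_assoc, zero_comp, sub_zero])
  rw [cocycleClass_eq_of_eq_add_d_comp I _ m t' c' c₁ g' (by rw [hc₁]; abel)]
  obtain ⟨t'', h', w, hdw, hw⟩ := exists_cocycle_lift I (m + 1) hI hS t'
    ((powResolution I t').extCocyclesι _ _ c₁)
    ((powResolution I t').d_comp_extCocyclesι _ _ c₁) (by
      change _ ≫ π = 0
      rw [hc₁, Preadditive.sub_comp, Category.assoc, hg', hc', Category.assoc, ← hb, hg, sub_self])
  obtain ⟨c₂, hc₂, hcl₂⟩ := exists_cocycleClass_eq_of_le I _ _ h' c₁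
  rw [← hcl₂]
  have he (k : Fin r) := (powResolution I t'').exists_extCocyclesι_eq (ModuleCat.of R R) (m + 1)
    (w ≫ e k) (by rw [← Category.assoc, hdw, zero_comp])
  choose z hz using he
  have hsum : c₂ = ∑ k, a k • z k := by
    refine (powResolution I t'').extCocyclesι_injective _ _ ?_
    rw [hc₂, ← hw, map_sum]
    refine (congr_arg (w ≫ ·) hα).trans ((Preadditive.comp_sum ..).trans ?_)
    exact Finset.sum_congr rfl fun k _ => by rw [map_smul, hz, Linear.comp_smul]
  rw [hsum, map_sum]
  refine Submodule.sum_mem _ fun k _ => ?_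
  rw [map_smul]
  exact Submodule.smul_mem_smul (ha ▸ Submodule.subset_span ⟨k, rfl⟩) trivial

end localCohomology

end TopDegree

/-- `Ass_R(D(H^i_{(x_1,…,x_i)R}(R))) ⊆ { p ∈ Spec R | H^i_{(x_1,…,x_i)R}(R/p) ≠ 0 }`. -/
theorem stmt7 (R : Type) [CommRing R] [IsLocalRing R] [IsNoetherianRing R]
    (i : ℕ) (hi : 1 ≤ i) (x : Fin i → R)
    (E : Type) [AddCommGroup E] [Module R E] (hE : IsInjectiveHullOfResidueField R E) :
    associatedPrimes R (LocalCohomologyModule (Ideal.span (Set.range x)) i R →ₗ[R] E) ⊆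
      { p : Ideal R | p.IsPrime ∧
        Nontrivial (LocalCohomologyModule (Ideal.span (Set.range x)) i (R ⧸ p)) } := by
  intro p hp
  have hprime : p.IsPrime := IsAssociatedPrime.isPrime hp
  refine ⟨hprime, not_subsingleton_iff_nontrivial.mp fun hsub => hprime.ne_top ?_⟩
  obtain ⟨-, φ, hφ⟩ := isAssociatedPrime_iff.mp hp
  obtain ⟨m, rfl⟩ : ∃ m, i = m + 1 := ⟨i - 1, by omega⟩
  have hzero : φ = 0 := by
    refine LinearMap.ext fun h => ?_
    have hmem := localCohomology.mem_smul_top_of_subsingleton (Ideal.span (Set.range x)) m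
      (localCohomology.cocyclesVanish_span_range x) p hsub h
    refine Submodule.smul_induction_on (p := fun y => φ y = 0) hmem (fun a ha y _ => ?_)
      fun y z hy hz => ?_
    · rw [hφ, Submodule.mem_colon_singleton, Submodule.mem_bot] at ha
      rw [map_smul, ← LinearMap.smul_apply, ha, LinearMap.zero_apply]
    · rw [map_add, hy, hz, add_zero]
  rw [hφ, hzero, Ideal.eq_top_iff_one, Submodule.mem_colon_singleton, smul_zero]
  exact zero_mem _
end

section
/- Let (R,m) be a noetherian local equicharacteristic ring (i.e. R contains a field), i ≥ 1, and x_1,…,x_i ∈ R. Then { p ∈ Spec(R) : the images of x_1,…,x_i in R/p are part of a system of parameters for R/p } ⊆ Ass_R(D(H^i_{(x_1,…,x_i)R}(R))). -/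
open IsLocalRing

/-- The images of `x_1,…,x_i` in `R/p` are part of a system of parameters for `R/p`:
there are `x_{i+1},…,x_n ∈ R` with `n = dim R/p` extending `x` such that the images of
`x_1,…,x_n` generate an ideal whose radical is the maximal ideal of `R/p`; equivalently
(entirely inside `R`), `√(p + (x_1,…,x_n)R) = m`. -/
def IsPartOfSystemOfParameters {R : Type} [CommRing R] [IsLocalRing R]
    (p : Ideal R) {i : ℕ} (x : Fin i → R) : Prop :=
  ∃ (n : ℕ) (h : i ≤ n) (y : Fin n → R),
    (∀ j : Fin i, y (Fin.castLE h j) = x j) ∧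
    ringKrullDim (R ⧸ p) = n ∧
    (p ⊔ Ideal.span (Set.range y)).radical = maximalIdeal R

namespace LocalCoh

open CategoryTheory CategoryTheory.Abelian

variable {R : Type} [CommRing R]

/-- The module `R / I ^ t` as an object of the category of modules. -/
noncomputable abbrev quotPow (I : Ideal R) (t : ℕ) : ModuleCat.{0} R := ModuleCat.of R (R ⧸ I ^ t)

/-- The projection between quotients `R / I ^ s → R / J ^ t` for `I ^ s ≤ J ^ t`. -/
noncomputable abbrev quotPowMap {I J : Ideal R} {s t : ℕ} (h : I ^ s ≤ J ^ t) :
    quotPow I s ⟶ quotPow J t :=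
  ModuleCat.ofHom (Submodule.mapQ _ _ LinearMap.id h)

lemma quotPowMap_comp {I J K : Ideal R} {s t u : ℕ} (h : I ^ s ≤ J ^ t) (h' : J ^ t ≤ K ^ u) :
    quotPowMap h ≫ quotPowMap h' = quotPowMap (h.trans h') := by
  ext
  rfl

lemma quotPowMap_self {I : Ideal R} {t : ℕ} (h : I ^ t ≤ I ^ t) :
    quotPowMap h = 𝟙 _ := by
  ext
  rfl

/-- Precomposition on `Ext` as a linear map. -/
noncomputable def extPre {X Y : ModuleCat.{0} R} (f : X ⟶ Y) (M : ModuleCat.{0} R) (j : ℕ) :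
    Abelian.Ext Y M j →ₗ[R] Abelian.Ext X M j where
  toFun e := (Ext.mk₀ f).comp e (zero_add j)
  map_add' := by simp
  map_smul' := by simp

lemma extPre_extPre {X Y Z : ModuleCat.{0} R} (f : X ⟶ Y) (g : Y ⟶ Z) (M : ModuleCat.{0} R)
    (j : ℕ) (e : Abelian.Ext Z M j) : extPre f M j (extPre g M j e) = extPre (f ≫ g) M j e := by
  change (Ext.mk₀ f).comp ((Ext.mk₀ g).comp e (zero_add j)) (zero_add j) =
    (Ext.mk₀ (f ≫ g)).comp e (zero_add j)
  rw [← Ext.mk₀_comp_mk₀, Ext.comp_assoc _ _ _ (zero_add 0) (zero_add j) (by lia)]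

/-- Postcomposition on `Ext` as a linear map. -/
noncomputable def extPost (X : ModuleCat.{0} R) {M N : ModuleCat.{0} R} {j k l : ℕ}
    (α : Abelian.Ext M N k) (h : j + k = l) : Abelian.Ext X M j →ₗ[R] Abelian.Ext X N l where
  toFun e := e.comp α h
  map_add' := by simp
  map_smul' := by simp

lemma extPre_extPost {X Y M N : ModuleCat.{0} R} {j k l : ℕ} (f : X ⟶ Y)
    (α : Abelian.Ext M N k) (h : j + k = l) (e : Abelian.Ext Y M j) :
    extPre f N l (extPost Y α h e) = extPost X α h (extPre f M j e) := by
  change (Ext.mk₀ f).comp (e.comp α h) (zero_add l) =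
    ((Ext.mk₀ f).comp e (zero_add j)).comp α h
  rw [Ext.comp_assoc _ _ _ (zero_add j) h (by lia)]

/-- The transition maps of the direct system computing local cohomology. -/
noncomputable def trans (I : Ideal R) (j : ℕ) (M : Type) [AddCommGroup M] [Module R M]
    (s t : ℕ) (h : s ≤ t) :
    Abelian.Ext (quotPow I s) (ModuleCat.of R M) j →ₗ[R]
      Abelian.Ext (quotPow I t) (ModuleCat.of R M) j :=
  extPre (quotPowMap (Ideal.pow_le_pow_right h)) _ j

instance (I : Ideal R) (j : ℕ) (M : Type) [AddCommGroup M] [Module R M] :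
    DirectedSystem (fun t : ℕ ↦ Abelian.Ext (quotPow I t) (ModuleCat.of R M) j)
      (trans I j M · · ·) where
  map_self t e := by
    simp [trans, extPre, quotPowMap_self]
  map_map s t u hs ht e := by
    simp only [trans]
    rw [extPre_extPre, quotPowMap_comp]

/-- Local cohomology with support in `I`, as a direct limit of `Ext` modules. -/
def LC (I : Ideal R) (j : ℕ) (M : Type) [AddCommGroup M] [Module R M] : Type :=
  Module.DirectLimit (fun t : ℕ ↦ Abelian.Ext (quotPow I t) (ModuleCat.of R M) j) (trans I j M)

namespace LC

variable (I : Ideal R) (j : ℕ) (M : Type) [AddCommGroup M] [Module R M]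

noncomputable instance : AddCommGroup (LC I j M) :=
  inferInstanceAs (AddCommGroup (Module.DirectLimit
    (fun t : ℕ ↦ Abelian.Ext (quotPow I t) (ModuleCat.of R M) j) (trans I j M)))

noncomputable instance : Module R (LC I j M) :=
  inferInstanceAs (Module R (Module.DirectLimit
    (fun t : ℕ ↦ Abelian.Ext (quotPow I t) (ModuleCat.of R M) j) (trans I j M)))

/-- The structure map from a stage of the direct system. -/
noncomputable def of (t : ℕ) :
    Abelian.Ext (quotPow I t) (ModuleCat.of R M) j →ₗ[R] LC I j M :=
  Module.DirectLimit.of R ℕ _ (trans I j M) t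

variable {I j M}

lemma of_trans {s t : ℕ} (h : s ≤ t) (e : Abelian.Ext (quotPow I s) (ModuleCat.of R M) j) :
    of I j M t (trans I j M s t h e) = of I j M s e :=
  Module.DirectLimit.of_f

lemma exists_of (a : LC I j M) : ∃ t e, of I j M t e = a :=
  Module.DirectLimit.exists_of a

lemma of_eq_zero {t : ℕ} {e : Abelian.Ext (quotPow I t) (ModuleCat.of R M) j}
    (h : of I j M t e = 0) : ∃ u, ∃ h : t ≤ u, trans I j M t u h e = 0 :=
  Module.DirectLimit.of.zero_exact (f := trans I j M) h

variable {N : Type} [AddCommGroup N] [Module R N]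

/-- The map induced by postcomposition with a class in `Ext`. -/
noncomputable def post (I : Ideal R) {k l : ℕ}
    (α : Abelian.Ext (ModuleCat.of R M) (ModuleCat.of R N) k) (h : j + k = l) :
    LC I j M →ₗ[R] LC I l N :=
  Module.DirectLimit.map (fun t ↦ extPost (quotPow I t) α h) (by
    intro s t hst
    ext1 e
    exact (extPre_extPost _ α h e).symm)

lemma post_of {k l : ℕ} (α : Abelian.Ext (ModuleCat.of R M) (ModuleCat.of R N) k) (h : j + k = l)
    {t : ℕ} (e : Abelian.Ext (quotPow I t) (ModuleCat.of R M) j) :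
    post I α h (of I j M t e) = of I l N t (extPost _ α h e) :=
  Module.DirectLimit.map_apply_of _ _ _

/-- The restriction map from a bigger to a smaller support. -/
noncomputable def res {I J : Ideal R} (h : I ≤ J) (j : ℕ) (M : Type) [AddCommGroup M]
    [Module R M] : LC J j M →ₗ[R] LC I j M :=
  Module.DirectLimit.map (fun t ↦ extPre (quotPowMap (Ideal.pow_right_mono h t)) _ j) (by
    intro s t hst
    ext1 e
    simp only [trans, LinearMap.comp_apply]
    rw [extPre_extPre, extPre_extPre, quotPowMap_comp, quotPowMap_comp])

lemma res_of {I J : Ideal R} (h : I ≤ J) {t : ℕ}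
    (e : Abelian.Ext (quotPow J t) (ModuleCat.of R M) j) :
    res h j M (of J j M t e) =
      of I j M t (extPre (quotPowMap (Ideal.pow_right_mono h t)) _ j e) :=
  Module.DirectLimit.map_apply_of _ _ _

lemma res_post {I J : Ideal R} (h : I ≤ J) {k l : ℕ}
    (α : Abelian.Ext (ModuleCat.of R M) (ModuleCat.of R N) k) (hl : j + k = l) (a : LC J j M) :
    res h l N (post J α hl a) = post I α hl (res h j M a) := by
  obtain ⟨t, e, rfl⟩ := exists_of a
  rw [post_of, res_of, res_of, post_of, extPre_extPost]

/-- Functoriality of local cohomology. -/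
noncomputable def map (I : Ideal R) (j : ℕ) (f : M →ₗ[R] N) : LC I j M →ₗ[R] LC I j N :=
  post I (Ext.mk₀ (ModuleCat.ofHom f)) (add_zero j)

variable {P : Type} [AddCommGroup P] [Module R P]

lemma map_map (f : M →ₗ[R] N) (g : N →ₗ[R] P) (a : LC I j M) :
    map I j g (map I j f a) = map I j (g ∘ₗ f) a := by
  obtain ⟨t, e, rfl⟩ := exists_of a
  simp only [map, post_of]
  congr 1
  change (e.comp _ (add_zero j)).comp _ (add_zero j) = e.comp _ (add_zero j)
  rw [Ext.comp_assoc _ _ _ (add_zero j) (add_zero 0) (by lia), Ext.mk₀_comp_mk₀]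
  rfl

lemma map_smul_id (r : R) (a : LC I j M) : map I j (r • LinearMap.id) a = r • a := by
  obtain ⟨t, e, rfl⟩ := exists_of a
  rw [map, post_of, ← map_smul, Ext.smul_eq_comp_mk₀]
  rfl

lemma map_zero_hom (a : LC I j M) : map I j (0 : M →ₗ[R] N) a = 0 := by
  obtain ⟨t, e, rfl⟩ := exists_of a
  rw [map, post_of]
  change of I j N t (e.comp _ (add_zero j)) = _
  rw [ModuleCat.ofHom_zero, Ext.mk₀_zero, Ext.comp_zero, map_zero]

/-- A short exact sequence of modules. -/
structure SES (f : M →ₗ[R] N) (g : N →ₗ[R] P) : Prop where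
  inj : Function.Injective f
  exact : Function.Exact f g
  surj : Function.Surjective g

namespace SES

variable {f : M →ₗ[R] N} {g : N →ₗ[R] P} (h : SES f g)

include h in
lemma comp_eq_zero : g ∘ₗ f = 0 := h.exact.linearMap_comp_eq_zero

/-- The associated short complex of objects in the category of modules. -/
abbrev shortComplex : ShortComplex (ModuleCat.{0} R) :=
  ShortComplex.mk (ModuleCat.ofHom f) (ModuleCat.ofHom g) (by
    rw [← ModuleCat.ofHom_comp, h.comp_eq_zero]; rfl)

lemma shortExact : h.shortComplex.ShortExact where
  exact := (ShortComplex.moduleCat_exact_iff _).2 fun x hx ↦ (h.exact x).1 hx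
  mono_f := (ModuleCat.mono_iff_injective _).2 h.inj
  epi_g := (ModuleCat.epi_iff_surjective _).2 h.surj

end SES

section exact

variable {f : M →ₗ[R] N} {g : N →ₗ[R] P} (h : SES f g)

/-- The connecting map in local cohomology. -/
noncomputable def δ (I : Ideal R) (j : ℕ) : LC I j P →ₗ[R] LC I (j + 1) M :=
  post I h.shortExact.extClass rfl

include h in
lemma exact_map_map (I : Ideal R) (j : ℕ) : Function.Exact (map I j f) (map I j g) := by
  intro a
  constructor
  · intro ha
    obtain ⟨t, e, rfl⟩ := exists_of a
    rw [map, post_of] at ha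
    obtain ⟨u, htu, hu⟩ := of_eq_zero ha
    rw [trans, extPre_extPost] at hu
    obtain ⟨x, hx⟩ := Ext.covariant_sequence_exact₂ _ h.shortExact _ hu
    refine ⟨of I j M u x, ?_⟩
    rw [← of_trans htu, map, post_of]
    exact congrArg _ hx
  · rintro ⟨b, rfl⟩
    rw [map_map, h.comp_eq_zero, map_zero_hom]

lemma exact_map_δ (I : Ideal R) (j : ℕ) : Function.Exact (map I j g) (δ h I j) := by
  intro a
  constructor
  · intro ha
    obtain ⟨t, e, rfl⟩ := exists_of a
    rw [δ, post_of] at ha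
    obtain ⟨u, htu, hu⟩ := of_eq_zero ha
    rw [trans, extPre_extPost] at hu
    obtain ⟨x, hx⟩ := Ext.covariant_sequence_exact₃ _ h.shortExact _ rfl hu
    refine ⟨of I j N u x, ?_⟩
    rw [← of_trans htu, map, post_of]
    exact congrArg _ hx
  · rintro ⟨b, rfl⟩
    obtain ⟨t, e, rfl⟩ := exists_of b
    rw [map, post_of, δ, post_of]
    change of I (j + 1) M t ((e.comp (Ext.mk₀ h.shortComplex.g) (add_zero j)).comp
      h.shortExact.extClass rfl) = 0
    rw [Ext.comp_assoc _ _ _ (add_zero j) (zero_add 1) (by lia),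
      ShortComplex.ShortExact.comp_extClass, Ext.comp_zero, map_zero]

lemma exact_δ_map (I : Ideal R) (j : ℕ) : Function.Exact (δ h I j) (map I (j + 1) f) := by
  intro a
  constructor
  · intro ha
    obtain ⟨t, e, rfl⟩ := exists_of a
    rw [map, post_of] at ha
    obtain ⟨u, htu, hu⟩ := of_eq_zero ha
    rw [trans, extPre_extPost] at hu
    obtain ⟨x, hx⟩ := Ext.covariant_sequence_exact₁ _ h.shortExact _ hu rfl
    refine ⟨of I j P u x, ?_⟩
    rw [← of_trans htu, δ, post_of]
    exact congrArg _ hx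
  · rintro ⟨b, rfl⟩
    obtain ⟨t, e, rfl⟩ := exists_of b
    rw [δ, post_of, map, post_of]
    change of I (j + 1) N t ((e.comp h.shortExact.extClass rfl).comp
      (Ext.mk₀ h.shortComplex.f) (add_zero (j + 1))) = 0
    rw [Ext.comp_assoc _ _ _ rfl (add_zero 1) (by lia), ShortComplex.ShortExact.extClass_comp,
      Ext.comp_zero, map_zero]

lemma res_δ {I J : Ideal R} (hI : I ≤ J) (j : ℕ) (a : LC J j P) :
    res hI (j + 1) M (δ h J j a) = δ h I j (res hI j P a) :=
  res_post _ _ _ _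

end exact

lemma res_map {I J : Ideal R} (hI : I ≤ J) (j : ℕ) (f : M →ₗ[R] N) (a : LC J j M) :
    res hI j N (map J j f a) = map I j f (res hI j M a) :=
  res_post _ _ _ _

lemma eq_zero_of_injective [CategoryTheory.Injective (ModuleCat.of R M)] (a : LC I (j + 1) M) :
    a = 0 := by
  obtain ⟨t, e, rfl⟩ := exists_of a
  rw [Ext.eq_zero_of_injective e, map_zero]

lemma eq_zero_of_bot (a : LC (⊥ : Ideal R) (j + 1) M) : a = 0 := by
  obtain ⟨t, e, rfl⟩ := exists_of a
  rw [← of_trans (Nat.le_succ t)]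
  have : Projective (quotPow (⊥ : Ideal R) (t + 1)) := by
    refine Projective.of_iso (P := ModuleCat.of R R) (LinearEquiv.toModuleIso ?_) ?_
    · exact (Submodule.quotEquivOfEqBot _ (by simp)).symm
    · infer_instance
  rw [Ext.eq_zero_of_projective (trans _ _ _ _ _ _ e), map_zero]

lemma exists_pow_smul (a : LC I j M) {r : R} (hr : r ∈ I) : ∃ t : ℕ, r ^ t • a = 0 := by
  obtain ⟨t, e, rfl⟩ := exists_of a
  refine ⟨t, ?_⟩
  rw [← map_smul]
  have : r ^ t • e = (Ext.mk₀ (r ^ t • 𝟙 (quotPow I t))).comp e (zero_add j) := by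
    rw [Ext.mk₀_smul, Ext.smul_comp, Ext.mk₀_id_comp]
  rw [this]
  have h0 : r ^ t • 𝟙 (quotPow I t) = 0 := by
    ext
    change r ^ t • (Ideal.Quotient.mk (I ^ t) 1) = 0
    rw [← Ideal.Quotient.mk_eq_mk, ← Submodule.Quotient.mk_smul, smul_eq_mul, mul_one]
    exact Ideal.Quotient.eq_zero_iff_mem.2 (Ideal.pow_mem_pow hr t)
  rw [h0, Ext.mk₀_zero, Ext.zero_comp, map_zero]

end LC

namespace LC

variable {I : Ideal R} {j : ℕ} {M N : Type} [AddCommGroup M] [Module R M]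
  [AddCommGroup N] [Module R N]

/-- Evaluation at `1` identifies degree zero local cohomology with torsion elements. -/
noncomputable def ev (I : Ideal R) (M : Type) [AddCommGroup M] [Module R M] : LC I 0 M →ₗ[R] M :=
  Module.DirectLimit.lift R ℕ _ _
    (fun t ↦ LinearMap.applyₗ (1 : R ⧸ I ^ t) ∘ₗ
      (ModuleCat.homLinearEquiv (S := R)).toLinearMap ∘ₗ Ext.linearEquiv₀.toLinearMap) (by
    intro s t hst e
    obtain ⟨g, rfl⟩ := (Ext.linearEquiv₀ (R := R)).symm.surjective e
    have h1 : trans I 0 M s t hst ((Ext.linearEquiv₀ (R := R)).symm g) =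
        (Ext.linearEquiv₀ (R := R)).symm (quotPowMap (Ideal.pow_le_pow_right hst) ≫ g) :=
      Ext.mk₀_comp_mk₀ _ _
    rw [h1]
    simp only [LinearMap.comp_apply, LinearEquiv.coe_coe, LinearEquiv.apply_symm_apply]
    rfl)

lemma ev_of_mk₀ {t : ℕ} (g : quotPow I t ⟶ ModuleCat.of R M) :
    ev I M (of I 0 M t (Ext.mk₀ g)) = g.hom (1 : R ⧸ I ^ t) := by
  refine (Module.DirectLimit.lift_of _ _ _).trans ?_
  have : Ext.mk₀ g = (Ext.linearEquiv₀ (R := R)).symm g := rfl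
  rw [this]
  simp only [LinearMap.comp_apply, LinearEquiv.coe_coe, LinearEquiv.apply_symm_apply]
  rfl

lemma exists_of_mk₀ (a : LC I 0 M) : ∃ t, ∃ g : quotPow I t ⟶ ModuleCat.of R M,
    of I 0 M t (Ext.mk₀ g) = a := by
  obtain ⟨t, e, rfl⟩ := exists_of a
  obtain ⟨g, rfl⟩ := (Ext.linearEquiv₀ (R := R)).symm.surjective e
  exact ⟨t, g, rfl⟩

lemma ev_injective : Function.Injective (ev I M) := by
  rw [injective_iff_map_eq_zero]
  intro a ha
  obtain ⟨t, g, rfl⟩ := exists_of_mk₀ a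
  rw [ev_of_mk₀] at ha
  have : g = 0 := by
    ext
    exact ha
  rw [this, Ext.mk₀_zero, map_zero]

lemma exists_ev_eq {m : M} {t : ℕ} (hm : ∀ r ∈ I ^ t, r • m = 0) : ∃ a, ev I M a = m := by
  refine ⟨of I 0 M t (Ext.mk₀ (ModuleCat.ofHom
    (Submodule.liftQ (I ^ t) (LinearMap.toSpanSingleton R M m) hm))), ?_⟩
  rw [ev_of_mk₀]
  exact one_smul R m

lemma ev_map (f : M →ₗ[R] N) (a : LC I 0 M) : ev I N (map I 0 f a) = f (ev I M a) := by
  obtain ⟨t, g, rfl⟩ := exists_of_mk₀ a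
  rw [map, post_of, ev_of_mk₀]
  change ev I N (of I 0 N t ((Ext.mk₀ g).comp _ (add_zero 0))) = _
  rw [Ext.mk₀_comp_mk₀, ev_of_mk₀]
  rfl

lemma ev_res {J : Ideal R} (h : I ≤ J) (a : LC J 0 M) : ev I M (res h 0 M a) = ev J M a := by
  obtain ⟨t, g, rfl⟩ := exists_of_mk₀ a
  rw [res_of, ev_of_mk₀]
  change ev I M (of I 0 M t ((Ext.mk₀ _).comp (Ext.mk₀ g) (add_zero 0))) = _
  rw [Ext.mk₀_comp_mk₀, ev_of_mk₀]
  rfl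

end LC

section comparison

variable {X Y : ModuleCat.{0} R} (P : ProjectiveResolution X) (j : ℕ)

/-- The cocycle underlying an element of the module of cycles. -/
noncomputable def cocycle (P : ProjectiveResolution X) (Y : ModuleCat.{0} R) (j : ℕ) :
    (P.complex.linearYonedaObj R Y).cycles j →ₗ[R] (P.complex.X j ⟶ Y) :=
  ((P.complex.linearYonedaObj R Y).iCycles j).hom

variable {P j}

lemma d_cocycle (z : (P.complex.linearYonedaObj R Y).cycles j) :
    P.complex.d (j + 1) j ≫ cocycle P Y j z = 0 :=
  congrArg (fun φ ↦ φ.hom z) ((P.complex.linearYonedaObj R Y).iCycles_d j (j + 1))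

lemma exists_cocycle_eq (f : P.complex.X j ⟶ Y) (hf : P.complex.d (j + 1) j ≫ f = 0) :
    ∃ z, cocycle P Y j z = f :=
  ⟨(P.complex.linearYonedaObj R Y).cyclesMk f (j + 1) (by simp) hf,
    (P.complex.linearYonedaObj R Y).i_cyclesMk f (j + 1) (by simp) hf⟩

lemma smul_extMk (r : R) (f : P.complex.X j ⟶ Y) (hf : P.complex.d (j + 1) j ≫ f = 0) :
    P.extMk (r • f) (j + 1) rfl (by rw [Linear.comp_smul, hf, smul_zero]) =
      r • P.extMk f (j + 1) rfl hf := by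
  rw [Ext.smul_eq_comp_mk₀, P.extMk_comp_mk₀]
  congr 1

/-- The map sending a cycle in the complex computing `Ext` to its class. -/
noncomputable def cyclesToExt (P : ProjectiveResolution X) (Y : ModuleCat.{0} R) (j : ℕ) :
    (P.complex.linearYonedaObj R Y).cycles j →ₗ[R] Abelian.Ext X Y j where
  toFun z := P.extMk (cocycle P Y j z) (j + 1) rfl (d_cocycle z)
  map_add' a b := by
    rw [P.add_extMk]
    congr 1
    exact map_add _ _ _
  map_smul' r a := by
    rw [RingHom.id_apply, ← smul_extMk]
    congr 1
    exact map_smul _ _ _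

lemma cyclesToExt_toCycles (i : ℕ) (y : (P.complex.linearYonedaObj R Y).X i) :
    cyclesToExt P Y j ((P.complex.linearYonedaObj R Y).toCycles i j y) = 0 := by
  have h : P.complex.d j i ≫ (y : P.complex.X i ⟶ Y) =
      cocycle P Y j ((P.complex.linearYonedaObj R Y).toCycles i j y) :=
    (congrArg (fun φ ↦ φ.hom y) ((P.complex.linearYonedaObj R Y).toCycles_i i j)).symm
  change P.extMk _ (j + 1) rfl (d_cocycle _) = 0
  by_cases hij : i + 1 = j
  · exact (P.extMk_eq_zero_iff _ _ rfl (d_cocycle _) i hij).2 ⟨_, h⟩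
  · have h0 : cocycle P Y j ((P.complex.linearYonedaObj R Y).toCycles i j y) = 0 := by
      rw [← h]
      exact (congrArg (· ≫ (y : P.complex.X i ⟶ Y)) (P.complex.shape j i hij)).trans
        Limits.zero_comp
    simp only [h0]
    exact P.extMk_zero _ _

/-- The comparison map from cohomology of the complex of homomorphisms to `Ext`. -/
noncomputable def homologyToExt (P : ProjectiveResolution X) (Y : ModuleCat.{0} R) (j : ℕ) :
    (P.complex.linearYonedaObj R Y).homology j ⟶ ModuleCat.of R (Abelian.Ext X Y j) :=
  ((P.complex.linearYonedaObj R Y).homologyIsCokernel _ j rfl).desc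
    (Limits.CokernelCofork.ofπ (ModuleCat.ofHom (cyclesToExt P Y j)) (by
      ext y
      exact cyclesToExt_toCycles _ y))

lemma homologyπ_homologyToExt :
    (P.complex.linearYonedaObj R Y).homologyπ j ≫ homologyToExt P Y j =
      ModuleCat.ofHom (cyclesToExt P Y j) :=
  ((P.complex.linearYonedaObj R Y).homologyIsCokernel _ j rfl).fac _
    Limits.WalkingParallelPair.one

lemma homologyToExt_surjective : Function.Surjective (homologyToExt P Y j) := by
  intro e
  obtain ⟨f, hf, rfl⟩ := P.extMk_surjective e (j + 1) rfl
  obtain ⟨z, rfl⟩ := exists_cocycle_eq f hf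
  exact ⟨(P.complex.linearYonedaObj R Y).homologyπ j z,
    congrArg (fun φ ↦ φ.hom z) homologyπ_homologyToExt⟩

/-- The map on complexes of homomorphisms induced by a map of resolutions. -/
noncomputable def yonedaMap {X' : ModuleCat.{0} R} {P' : ProjectiveResolution X'}
    (φ : P'.complex ⟶ P.complex) (Y : ModuleCat.{0} R) :
    P.complex.linearYonedaObj R Y ⟶ P'.complex.linearYonedaObj R Y :=
  (HomologicalComplex.unopFunctor _ _).map
    (((((linearYoneda R (ModuleCat.{0} R)).obj Y).rightOp.mapHomologicalComplex _).map φ).op)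

lemma cocycle_cyclesMap {X' : ModuleCat.{0} R} {P' : ProjectiveResolution X'}
    (φ : P'.complex ⟶ P.complex) (z : (P.complex.linearYonedaObj R Y).cycles j) :
    cocycle P' Y j (HomologicalComplex.cyclesMap (yonedaMap φ Y) j z) =
      φ.f j ≫ cocycle P Y j z :=
  congrArg (fun ψ ↦ ψ.hom z) (HomologicalComplex.cyclesMap_i (yonedaMap φ Y) j)

lemma homologyToExt_naturality {X' : ModuleCat.{0} R} {P' : ProjectiveResolution X'} {g : X' ⟶ X}
    (φ : ProjectiveResolution.Hom P' P g) :
    HomologicalComplex.homologyMap (yonedaMap φ.hom Y) j ≫ homologyToExt P' Y j =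
      homologyToExt P Y j ≫ ModuleCat.ofHom (extPre g Y j) := by
  rw [← cancel_epi ((P.complex.linearYonedaObj R Y).homologyπ j),
    ← Category.assoc, ← Category.assoc, homologyπ_homologyToExt,
    HomologicalComplex.homologyπ_naturality, Category.assoc, homologyπ_homologyToExt]
  ext z
  have h := P.mk₀_comp_extMk (cocycle P Y j z) (j + 1) rfl (d_cocycle z) φ
  refine Eq.trans ?_ h.symm
  change P'.extMk (cocycle P' Y j (HomologicalComplex.cyclesMap (yonedaMap φ.hom Y) j z)) (j + 1)
    rfl (d_cocycle _) = _
  congr 1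
  exact cocycle_cyclesMap _ _

/-- The comparison of the derived functor `Ext` with `Ext` defined via the derived category. -/
noncomputable def oldExtTo (X Y : ModuleCat.{0} R) (j : ℕ) :
    ((_root_.Ext R (ModuleCat.{0} R) j).obj (Opposite.op X)).obj Y ⟶
      ModuleCat.of R (Abelian.Ext X Y j) :=
  ((projectiveResolution X).isoExt j Y).hom ≫ homologyToExt _ Y j

lemma oldExtTo_surjective (X Y : ModuleCat.{0} R) (j : ℕ) :
    Function.Surjective (oldExtTo X Y j) :=
  homologyToExt_surjective.comp
    ((ModuleCat.epi_iff_surjective _).1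
      (inferInstance : Epi ((projectiveResolution X).isoExt j Y).hom))

lemma isoExt_inv_naturality {X X' : ModuleCat.{0} R} {P : ProjectiveResolution X}
    {P' : ProjectiveResolution X'} {g : X' ⟶ X} (φ : ProjectiveResolution.Hom P' P g)
    (Y : ModuleCat.{0} R) (j : ℕ) :
    (P.isoExt j Y).inv ≫ ((_root_.Ext R (ModuleCat.{0} R) j).map g.op).app Y =
      HomologicalComplex.homologyMap (yonedaMap φ.hom Y) j ≫ (P'.isoExt j Y).inv := by
  have h1 := congrArg Quiver.Hom.unop (ProjectiveResolution.isoLeftDerivedObj_hom_naturality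
    g P' P φ.hom φ.hom_f_zero_comp_π_f_zero
      ((linearYoneda R (ModuleCat.{0} R)).obj Y).rightOp j)
  have h2 := congrArg Quiver.Hom.unop
    (HomologicalComplex.homologyOp_hom_naturality (yonedaMap φ.hom Y) j)
  refine (Category.assoc _ _ _).trans ((congrArg (_ ≫ ·) h1).trans ?_)
  refine (Category.assoc _ _ _).symm.trans ((congrArg (· ≫ _) h2).trans ?_)
  exact Category.assoc _ _ _

lemma oldExtTo_naturality {X X' : ModuleCat.{0} R} (g : X' ⟶ X) (Y : ModuleCat.{0} R) (j : ℕ) :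
    ((_root_.Ext R (ModuleCat.{0} R) j).map g.op).app Y ≫ oldExtTo X' Y j =
      oldExtTo X Y j ≫ ModuleCat.ofHom (extPre g Y j) := by
  let φ : ProjectiveResolution.Hom (projectiveResolution X') (projectiveResolution X) g :=
    ⟨ProjectiveResolution.lift g _ _, ProjectiveResolution.lift_commutes_zero g _ _⟩
  have h := isoExt_inv_naturality φ Y j
  rw [oldExtTo, oldExtTo, Category.assoc, ← homologyToExt_naturality φ,
    ← Iso.inv_comp_eq, ← Category.assoc, h, Category.assoc, Iso.inv_hom_id_assoc]

end comparison

section colimit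

open Limits

variable (I : Ideal R) (j : ℕ) (M : Type) [AddCommGroup M] [Module R M]

/-- The diagram of modules whose colimit is local cohomology. -/
noncomputable abbrev evalDiagram : ℕᵒᵖᵒᵖ ⥤ ModuleCat.{0} R :=
  localCohomology.diagram (localCohomology.idealPowersDiagram I) j ⋙
    (evaluation (ModuleCat.{0} R) (ModuleCat.{0} R)).obj (ModuleCat.of R M)

/-- Local cohomology is the colimit of its evaluated diagram. -/
noncomputable def isColimitEval : IsColimit
    (((evaluation (ModuleCat.{0} R) (ModuleCat.{0} R)).obj (ModuleCat.of R M)).mapCocone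
      (colimit.cocone (localCohomology.diagram (localCohomology.idealPowersDiagram I) j))) :=
  isColimitOfPreserves _ (colimit.isColimit _)

/-- The cocone given by the comparison maps. -/
noncomputable def compCocone : Cocone (evalDiagram I j M) where
  pt := ModuleCat.of R (LC I j M)
  ι :=
    { app := fun t ↦ oldExtTo (quotPow I t.unop.unop) (ModuleCat.of R M) j ≫
        ModuleCat.ofHom (LC.of I j M t.unop.unop)
      naturality := fun s t f ↦ by
        have h := oldExtTo_naturality
          (quotPowMap (Ideal.pow_le_pow_right (I := I) f.unop.unop.down.down))
          (ModuleCat.of R M) j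
        refine (Category.assoc _ _ _).symm.trans ((congrArg (· ≫ _) h).trans ?_)
        ext a
        exact LC.of_trans f.unop.unop.down.down _ }

/-- The comparison map from local cohomology. -/
noncomputable def compHom : LocalCohomologyModule I j M →ₗ[R] LC I j M :=
  ((isColimitEval I j M).desc (compCocone I j M)).hom

lemma compHom_surjective : Function.Surjective (compHom I j M) := by
  intro a
  obtain ⟨t, e, rfl⟩ := LC.exists_of a
  obtain ⟨b, rfl⟩ := oldExtTo_surjective _ _ _ e
  exact ⟨_, congrArg (fun φ ↦ φ.hom b)
    ((isColimitEval I j M).fac (compCocone I j M) (Opposite.op (Opposite.op t)))⟩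

end colimit

namespace LC

section cofiber

variable {R : Type} [CommRing R]

lemma exists_linearMap_of_relation {A C : Type} [AddCommGroup A] [Module R A] [AddCommGroup C]
    [Module R C] (S : Submodule R (A × C)) (total : ∀ a, ∃ c, (a, c) ∈ S)
    (unique : ∀ c, (0, c) ∈ S → c = 0) : ∃ f : A →ₗ[R] C, ∀ a c, (a, c) ∈ S → f a = c := by
  choose f hf using total
  have key : ∀ a c, (a, c) ∈ S → f a = c := by
    intro a c h
    rw [← sub_eq_zero]
    apply unique
    simpa using S.sub_mem (hf a) h
  exact ⟨{ toFun := f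
           map_add' := fun a b ↦ key _ _ (by simpa using S.add_mem (hf a) (hf b))
           map_smul' := fun r a ↦ key _ _ (by simpa using S.smul_mem r (hf a)) }, key⟩

lemma exists_injective_ses (M : Type) [AddCommGroup M] [Module R M] :
    ∃ (J : Type) (_ : AddCommGroup J) (_ : Module R J) (Q : Type) (_ : AddCommGroup Q)
      (_ : Module R Q) (f : M →ₗ[R] J) (g : J →ₗ[R] Q),
      CategoryTheory.Injective (ModuleCat.of R J) ∧ SES f g := by
  let f := (Injective.ι (ModuleCat.of R M)).hom
  refine ⟨(Injective.under (ModuleCat.of R M) : ModuleCat R), inferInstance, inferInstance, _,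
    inferInstance, inferInstance, f, (LinearMap.range f).mkQ,
    inferInstanceAs (CategoryTheory.Injective (Injective.under (ModuleCat.of R M))),
    (ModuleCat.mono_iff_injective _).1 inferInstance, ?_, Submodule.mkQ_surjective _⟩
  exact LinearMap.exact_map_mkQ_range f

variable {I : Ideal R} {M N : Type} [AddCommGroup M] [Module R M] [AddCommGroup N] [Module R N]

lemma map_injective_zero {f : M →ₗ[R] N} (hf : Function.Injective f) :
    Function.Injective (map I 0 f) := by
  intro a b h
  apply ev_injective
  apply hf
  rw [← ev_map, ← ev_map, h]

lemma res_injective_zero {K : Ideal R} (h : I ≤ K) : Function.Injective (res h 0 M) := by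
  intro a b hab
  apply ev_injective
  rw [← ev_res h, ← ev_res h, hab]

lemma pow_smul_ev_eq_zero (a : LC I 0 M) : ∃ t, ∀ r ∈ I ^ t, r • ev I M a = 0 := by
  obtain ⟨t, g, rfl⟩ := exists_of_mk₀ a
  refine ⟨t, fun r hr ↦ ?_⟩
  rw [ev_of_mk₀, ← map_smul]
  have : r • (1 : R ⧸ I ^ t) = 0 := by
    rw [Algebra.smul_def, mul_one]
    exact Ideal.Quotient.eq_zero_iff_mem.2 hr
  rw [this, map_zero]

lemma exists_smul_eq_of_injective [IsNoetherianRing R] {J : Type} [AddCommGroup J] [Module R J]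
    [CategoryTheory.Injective (ModuleCat.of R J)] (j : ℕ) (e : LC I j J) (x : R) (k : ℕ) :
    ∃ s b, x ^ s • e = x ^ (k + s) • b := by
  cases j with
  | succ j => exact ⟨0, 0, by rw [eq_zero_of_injective e, smul_zero, smul_zero]⟩
  | zero =>
    obtain ⟨t, ht⟩ := pow_smul_ev_eq_zero e
    let φ : ℕ → R →ₗ[R] R ⧸ I ^ t := fun s ↦ LinearMap.toSpanSingleton R _ (x ^ s • 1)
    have hφ : ∀ s r, φ s r = Ideal.Quotient.mk (I ^ t) (x ^ s * r) := by
      intro s r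
      simp only [φ, LinearMap.toSpanSingleton_apply, Algebra.smul_def, mul_one, map_mul]
      exact mul_comm _ _
    have hker : ∀ s r, r ∈ LinearMap.ker (φ s) ↔ x ^ s * r ∈ I ^ t := by
      intro s r
      rw [LinearMap.mem_ker, hφ, Ideal.Quotient.eq_zero_iff_mem]
    have hmono : Monotone fun s ↦ LinearMap.ker (φ s) := by
      refine monotone_nat_of_le_succ fun s r hr ↦ ?_
      rw [hker] at hr ⊢
      rw [pow_succ', mul_assoc]
      exact Ideal.mul_mem_left _ _ hr
    obtain ⟨s, hs⟩ := monotone_stabilizes_iff_noetherian.2 inferInstance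
      (⟨_, hmono⟩ : ℕ →o Submodule R R)
    have hs' : LinearMap.ker (φ (k + s)) = LinearMap.ker (φ s) := (hs (k + s) (by lia)).symm
    let ψ : R →ₗ[R] J := LinearMap.toSpanSingleton R J (x ^ s • ev I J e)
    have hle : LinearMap.ker (φ (k + s)) ≤ LinearMap.ker ψ := by
      intro r hr
      rw [hs', hker] at hr
      rw [LinearMap.mem_ker, LinearMap.toSpanSingleton_apply, smul_smul, mul_comm]
      exact ht _ hr
    let i : ModuleCat.of R (R ⧸ LinearMap.ker (φ (k + s))) ⟶ quotPow I t :=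
      ModuleCat.ofHom ((LinearMap.ker (φ (k + s))).liftQ (φ (k + s)) le_rfl)
    have : Mono i := (ModuleCat.mono_iff_injective _).2
      (LinearMap.ker_eq_bot.1 (Submodule.ker_liftQ_eq_bot _ _ _ le_rfl))
    let h := Injective.factorThru (ModuleCat.ofHom ((LinearMap.ker (φ (k + s))).liftQ ψ hle)) i
    have hcomp : h.hom (φ (k + s) 1) = ψ 1 :=
      congrArg (fun f ↦ f.hom (Submodule.Quotient.mk 1)) (Injective.comp_factorThru
        (ModuleCat.ofHom ((LinearMap.ker (φ (k + s))).liftQ ψ hle)) i)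
    obtain ⟨b, hb⟩ := exists_ev_eq (I := I) (t := t) (m := h.hom (1 : R ⧸ I ^ t)) (by
      intro r hr
      rw [← map_smul, Algebra.smul_def, mul_one]
      erw [Ideal.Quotient.eq_zero_iff_mem.2 hr]
      exact map_zero _)
    refine ⟨s, b, ev_injective ?_⟩
    rw [map_smul (ev I J), map_smul (ev I J), hb]
    simp only [φ, ψ, LinearMap.toSpanSingleton_apply, one_smul] at hcomp
    exact hcomp.symm.trans (map_smul _ _ _)

/-- The maps relating local cohomology with support in `I` and in `I + (x)`: `κ k` sends
`e` to the image of `e / x ^ k` under the connecting map. -/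
structure Connecting {I K : Ideal R} (hIK : I ≤ K) (x : R) (j : ℕ) (M : Type) [AddCommGroup M]
    [Module R M] (κ : ℕ → LC I j M →ₗ[R] LC K (j + 1) M) : Prop where
  eq_zero_iff : ∀ k e, κ k e = 0 ↔ ∃ s e', x ^ s • e = x ^ (k + s) • e'
  res_eq_zero_iff : ∀ a, res hIK (j + 1) M a = 0 ↔ ∃ k e, κ k e = a
  succ : ∀ k e, κ (k + 1) (x • e) = κ k e
  exists_res_eq : ∀ k (e : LC I (j + 1) M), x ^ k • e = 0 → ∃ a, res hIK (j + 1) M a = e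

variable {K : Ideal R} {x : R}

lemma exists_res_zero (hIK : I ≤ K) (hK : K = I ⊔ Ideal.span {x}) {k : ℕ} {e : LC I 0 M}
    (he : x ^ k • e = 0) : ∃ a, res hIK 0 M a = e := by
  obtain ⟨t, ht⟩ := pow_smul_ev_eq_zero e
  obtain ⟨a, ha⟩ := exists_ev_eq (I := K) (t := t + k) (m := ev I M e) (by
    intro r hr
    rw [hK] at hr
    have := Ideal.sup_pow_add_le_pow_sup_pow hr
    obtain ⟨y, hy, z, hz, rfl⟩ := Submodule.mem_sup.1 this
    rw [Ideal.span_singleton_pow] at hz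
    obtain ⟨c, rfl⟩ := Ideal.mem_span_singleton'.1 hz
    rw [add_smul, ht y hy, mul_smul, ← map_smul, he, map_zero, smul_zero, add_zero])
  exact ⟨a, ev_injective (by rw [ev_res, ha])⟩

lemma exists_connecting [IsNoetherianRing R] (hIK : I ≤ K) (hK : K = I ⊔ Ideal.span {x}) (j : ℕ) :
    ∀ (M : Type) [AddCommGroup M] [Module R M], ∃ κ, Connecting hIK x j M κ := by
  have hx : x ∈ K := by
    rw [hK]
    exact Ideal.mem_sup_right (Ideal.mem_span_singleton_self x)
  induction j with
  | zero =>
    intro M _ _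
    obtain ⟨J, _, _, Q, _, _, f, g, hJ, h⟩ := exists_injective_ses (R := R) M
    let S (k : ℕ) : Submodule R (LC I 0 M × LC K 1 M) :=
      { carrier := { p | ∃ b c s, x ^ s • map I 0 f p.1 = x ^ (k + s) • b ∧
          map I 0 g b = res hIK 0 Q c ∧ δ h K 0 c = p.2 }
        zero_mem' := ⟨0, 0, 0, by simp⟩
        add_mem' := by
          rintro p p' ⟨b, c, s, h1, h2, h3⟩ ⟨b', c', s', h1', h2', h3'⟩
          refine ⟨b + b', c + c', s + s', ?_, by rw [map_add, map_add, h2, h2'],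
            by rw [map_add, h3, h3', Prod.snd_add]⟩
          rw [Prod.fst_add, map_add, smul_add, smul_add]
          congr 1
          · rw [add_comm s, pow_add, mul_smul, h1, smul_smul, ← pow_add]
            congr 2
            lia
          · rw [pow_add, mul_smul, h1', smul_smul, ← pow_add]
            congr 2
            lia
        smul_mem' := by
          rintro r p ⟨b, c, s, h1, h2, h3⟩
          refine ⟨r • b, r • c, s, ?_, by rw [map_smul, map_smul, h2],
            by rw [map_smul, h3, Prod.smul_snd]⟩
          rw [Prod.smul_fst, map_smul, smul_comm, h1, smul_comm] }
    have hmapmap : ∀ a, map I 0 g (map I 0 f a) = 0 := fun a ↦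
      ((exact_map_map h I 0) _).2 ⟨a, rfl⟩
    have htotal : ∀ k a, ∃ c, (a, c) ∈ S k := by
      intro k a
      obtain ⟨s, b, hb⟩ := exists_smul_eq_of_injective 0 (map I 0 f a) x k
      obtain ⟨c, hc⟩ := exists_res_zero hIK hK (k := k + s) (e := map I 0 g b) (by
        rw [← map_smul, ← hb, map_smul, hmapmap, smul_zero])
      exact ⟨δ h K 0 c, b, c, s, hb, hc.symm, rfl⟩
    have hzero : ∀ k a, (a, 0) ∈ S k → ∃ s e', x ^ s • a = x ^ (k + s) • e' := by
      rintro k a ⟨b, c, s, h1, h2, h3⟩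
      obtain ⟨c1, rfl⟩ := ((exact_map_δ h K 0) c).1 h3
      obtain ⟨N, hN⟩ := exists_pow_smul c1 hx
      rw [res_map, ← sub_eq_zero, ← map_sub] at h2
      obtain ⟨e', he'⟩ := ((exact_map_map h I 0) _).1 h2
      refine ⟨s + N, e', map_injective_zero h.inj ?_⟩
      dsimp only at h1
      have hN' : x ^ (k + (s + N)) • res hIK 0 J c1 = 0 := by
        rw [← add_assoc, pow_add, mul_smul, ← map_smul, hN, map_zero, smul_zero]
      rw [map_smul, map_smul, he', smul_sub, hN', sub_zero, add_comm s, pow_add, mul_smul, h1,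
        smul_smul, ← pow_add]
      congr 2
      lia
    have hunique : ∀ k c, (0, c) ∈ S k → c = 0 := by
      rintro k c' ⟨b, c, s, h1, h2, rfl⟩
      dsimp only at h1 ⊢
      rw [map_zero, smul_zero] at h1
      obtain ⟨c1, hc1⟩ := exists_res_zero hIK hK h1.symm
      refine ((exact_map_δ h K 0) c).2 ⟨c1, res_injective_zero hIK ?_⟩
      rw [res_map, hc1, h2]
    choose κ hκ using fun k ↦ exists_linearMap_of_relation (S k) (htotal k) (hunique k)
    have hκ' : ∀ k e, (e, κ k e) ∈ S k := by
      intro k e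
      obtain ⟨c, hc⟩ := htotal k e
      rwa [hκ k e c hc]
    refine ⟨κ, ?_, ?_, ?_, ?_⟩
    · intro k e
      constructor
      · intro h0
        exact hzero k e (h0 ▸ hκ' k e)
      · rintro ⟨s, e', he'⟩
        exact hκ k e 0 ⟨map I 0 f e', 0, s, by rw [← map_smul, he', map_smul],
          by rw [hmapmap, map_zero], map_zero _⟩
    · intro a
      constructor
      · intro ha
        obtain ⟨c, rfl⟩ := ((exact_δ_map h K 0) a).1 (eq_zero_of_injective _)
        rw [res_δ] at ha
        obtain ⟨b, hb⟩ := ((exact_map_δ h I 0) _).1 ha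
        obtain ⟨N, hN⟩ := exists_pow_smul c hx
        obtain ⟨e, he⟩ := ((exact_map_map h I 0) (x ^ N • b)).1 (by
          rw [map_smul, hb, ← map_smul, hN, map_zero])
        exact ⟨N, e, hκ N e _ ⟨b, c, 0, by simpa using he, hb, rfl⟩⟩
      · rintro ⟨k, e, rfl⟩
        obtain ⟨b, c, s, h1, h2, h3⟩ := hκ' k e
        refine (congrArg (res hIK 1 M) h3.symm).trans ?_
        rw [res_δ, ← h2]
        exact ((exact_map_δ h I 0) _).2 ⟨b, rfl⟩
    · intro k e
      obtain ⟨b, c, s, h1, h2, h3⟩ := hκ' k e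
      refine hκ _ _ _ ⟨b, c, s, ?_, h2, h3⟩
      dsimp only at h1 ⊢
      rw [map_smul, smul_comm, h1, smul_smul, ← pow_succ']
      congr 2
      lia
    · intro k e he
      obtain ⟨q, rfl⟩ := ((exact_δ_map h I 0) e).1 (eq_zero_of_injective _)
      rw [← map_smul] at he
      obtain ⟨b, hb⟩ := ((exact_map_δ h I 0) _).1 he
      obtain ⟨s, b', hb'⟩ := exists_smul_eq_of_injective 0 b x k
      obtain ⟨c, hc⟩ := exists_res_zero hIK hK (k := k + s) (e := q - map I 0 g b') (by
        rw [smul_sub, ← map_smul, ← hb', map_smul, hb, smul_smul, ← pow_add, add_comm, sub_self])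
      refine ⟨δ h K 0 c, ?_⟩
      rw [res_δ, hc, map_sub, sub_eq_self]
      exact ((exact_map_δ h I 0) _).2 ⟨b', rfl⟩
  | succ j ih =>
    intro M _ _
    obtain ⟨J, _, _, Q, _, _, f, g, hJ, h⟩ := exists_injective_ses (R := R) M
    obtain ⟨κ', hκ'⟩ := ih Q
    have hδ : ∀ e : LC I (j + 1) M, ∃ u, δ h I j u = e := fun e ↦
      ((exact_δ_map h I j) e).1 (eq_zero_of_injective _)
    have hδinj : ∀ (I : Ideal R) (q : LC I (j + 1) Q), δ h I (j + 1) q = 0 → q = 0 := by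
      intro I q hq
      obtain ⟨b, rfl⟩ := ((exact_map_δ h I (j + 1)) q).1 hq
      rw [eq_zero_of_injective b, map_zero]
    have hvan : ∀ k b, κ' k (map I j g b) = 0 := by
      intro k b
      obtain ⟨s, b', hb'⟩ := exists_smul_eq_of_injective j b x k
      exact (hκ'.eq_zero_iff _ _).2 ⟨s, map I j g b', by rw [← map_smul, hb', map_smul]⟩
    have hex : ∀ k, ∃ F : LC I (j + 1) M →ₗ[R] LC K (j + 2) M,
        ∀ u, F (δ h I j u) = δ h K (j + 1) (κ' k u) := by
      intro k
      obtain ⟨F, hF⟩ := exists_linearMap_of_relation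
        (LinearMap.range ((δ h I j).prod (δ h K (j + 1) ∘ₗ κ' k)))
        (fun a ↦ by
          obtain ⟨u, rfl⟩ := hδ a
          exact ⟨_, u, rfl⟩)
        (by
          rintro c ⟨u, hu⟩
          obtain ⟨b, rfl⟩ := ((exact_map_δ h I j) u).1 (congrArg Prod.fst hu)
          refine (congrArg Prod.snd hu).symm.trans ?_
          change δ h K (j + 1) (κ' k (map I j g b)) = 0
          rw [hvan, map_zero])
      exact ⟨F, fun u ↦ hF _ _ ⟨u, rfl⟩⟩
    choose κ hκ using hex
    refine ⟨κ, ?_, ?_, ?_, ?_⟩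
    · intro k e
      obtain ⟨u, rfl⟩ := hδ e
      rw [hκ]
      constructor
      · intro h0
        obtain ⟨s, e', he'⟩ := (hκ'.eq_zero_iff _ _).1 (hδinj K _ h0)
        exact ⟨s, δ h I j e', by rw [← map_smul, he', map_smul]⟩
      · rintro ⟨s, e', he'⟩
        obtain ⟨u', rfl⟩ := hδ e'
        rw [← map_smul, ← map_smul, ← sub_eq_zero, ← map_sub] at he'
        obtain ⟨v, hv⟩ := ((exact_map_δ h I j) _).1 he'
        obtain ⟨t, b, hb⟩ := exists_smul_eq_of_injective j v x (k + s)
        rw [(hκ'.eq_zero_iff _ _).2 ⟨t + s, u' + map I j g b, ?_⟩, map_zero]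
        rw [eq_sub_iff_add_eq] at hv
        rw [pow_add, mul_smul, ← hv, smul_add, ← map_smul, hb, map_smul, smul_smul, ← pow_add,
          smul_add, add_comm, ← add_assoc k, add_right_comm k, add_comm t]
        rw [add_right_comm k t s]
    · intro a
      constructor
      · intro ha
        obtain ⟨a', rfl⟩ := ((exact_δ_map h K (j + 1)) a).1 (eq_zero_of_injective _)
        rw [res_δ] at ha
        obtain ⟨k, u, rfl⟩ := (hκ'.res_eq_zero_iff _).1 (hδinj I _ ha)
        exact ⟨k, δ h I j u, hκ _ _⟩
      · rintro ⟨k, e, rfl⟩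
        obtain ⟨u, rfl⟩ := hδ e
        rw [hκ, res_δ, (hκ'.res_eq_zero_iff _).2 ⟨k, u, rfl⟩, map_zero]
    · intro k e
      obtain ⟨u, rfl⟩ := hδ e
      rw [← map_smul, hκ, hκ, hκ'.succ]
    · intro k e he
      obtain ⟨q, rfl⟩ := ((exact_δ_map h I (j + 1)) e).1 (eq_zero_of_injective _)
      rw [← map_smul] at he
      obtain ⟨a, rfl⟩ := hκ'.exists_res_eq k q (hδinj I _ he)
      exact ⟨δ h K (j + 1) a, res_δ _ _ _ _⟩

end cofiber
end LC

namespace LC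

section list

variable {R : Type} [CommRing R] {M : Type} [AddCommGroup M] [Module R M]

lemma ofList_le_cons (x : R) (xs : List R) : Ideal.ofList xs ≤ Ideal.ofList (x :: xs) := by
  rw [Ideal.ofList_cons]
  exact le_sup_right

lemma ofList_cons_eq (x : R) (xs : List R) :
    Ideal.ofList (x :: xs) = Ideal.ofList xs ⊔ Ideal.span {x} := by
  rw [Ideal.ofList_cons, sup_comm]

lemma eq_zero_of_length_lt [IsNoetherianRing R] (xs : List R) {j : ℕ} (hj : xs.length < j)
    (a : LC (Ideal.ofList xs) j M) : a = 0 := by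
  induction xs generalizing j with
  | nil =>
    obtain ⟨j, rfl⟩ := Nat.exists_eq_succ_of_ne_zero hj.ne'
    revert a
    rw [Ideal.ofList_nil]
    exact eq_zero_of_bot
  | cons x xs ih =>
    obtain ⟨j, rfl⟩ := Nat.exists_eq_succ_of_ne_zero (Nat.ne_zero_of_lt hj)
    obtain ⟨κ, hκ⟩ := exists_connecting (ofList_le_cons x xs) (ofList_cons_eq x xs) j M
    rw [List.length_cons] at hj
    obtain ⟨k, e, rfl⟩ := (hκ.res_eq_zero_iff a).1 (ih (by lia) _)
    rw [ih (by lia) e, map_zero]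

lemma eq_zero_of_locally_nilpotent [IsNoetherianRing R] (xs : List R)
    (h : ∀ x ∈ xs, ∀ m : M, ∃ k : ℕ, x ^ k • m = 0) {j : ℕ}
    (a : LC (Ideal.ofList xs) (j + 1) M) : a = 0 := by
  induction xs generalizing j with
  | nil => exact eq_zero_of_length_lt _ (by simp) a
  | cons x xs ih =>
    have ih' : ∀ {j} (a : LC (Ideal.ofList xs) (j + 1) M), a = 0 :=
      ih (fun y hy ↦ h y (List.mem_cons_of_mem _ hy))
    obtain ⟨κ, hκ⟩ := exists_connecting (ofList_le_cons x xs) (ofList_cons_eq x xs) j M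
    obtain ⟨k, e, rfl⟩ := (hκ.res_eq_zero_iff a).1 (ih' _)
    cases j with
    | succ j => rw [ih' e, map_zero]
    | zero =>
      obtain ⟨s, hs⟩ := h x List.mem_cons_self (ev _ M e)
      refine (hκ.eq_zero_iff k e).2 ⟨s, 0, ev_injective ?_⟩
      rw [map_smul, hs, smul_zero, map_zero]

/-- The submodule generated by the `n`-th powers of the elements of a list. -/
def powSubmodule (xs : List R) (n : ℕ) (M : Type) [AddCommGroup M] [Module R M] :
    Submodule R M :=
  Ideal.span ((· ^ n) '' {x | x ∈ xs}) • ⊤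

lemma pow_smul_mem {xs : List R} {n : ℕ} {x : R} (hx : x ∈ xs) (m : M) :
    x ^ n • m ∈ powSubmodule xs n M :=
  Submodule.smul_mem_smul (Ideal.subset_span ⟨x, hx, rfl⟩) trivial

lemma powSubmodule_le {xs : List R} {n : ℕ} {N : Submodule R M}
    (h : ∀ x ∈ xs, ∀ m : M, x ^ n • m ∈ N) : powSubmodule xs n M ≤ N := by
  refine Submodule.smul_le.2 fun r hr m _ ↦ ?_
  have : Ideal.span ((· ^ n) '' {x | x ∈ xs}) ≤ N.comap (LinearMap.toSpanSingleton R M m) := by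
    refine Ideal.span_le.2 ?_
    rintro _ ⟨x, hx, rfl⟩
    exact h x hx m
  exact this hr

lemma prod_pow_smul_mem {xs ys : List R} (hys : ∀ y ∈ ys, y ∈ xs) {n s : ℕ} {m : M}
    (hm : m ∈ powSubmodule ys n M) : ys.prod ^ s • m ∈ powSubmodule xs (n + s) M := by
  suffices h : powSubmodule ys n M ≤
      (powSubmodule xs (n + s) M).comap (LinearMap.lsmul R M (ys.prod ^ s)) from h hm
  refine powSubmodule_le fun x hx m ↦ ?_
  obtain ⟨c, hc⟩ := List.dvd_prod hx
  change ys.prod ^ s • x ^ n • m ∈ powSubmodule xs (n + s) M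
  have : ys.prod ^ s • x ^ n • m = x ^ (n + s) • c ^ s • m := by
    rw [smul_smul, smul_smul, hc]
    ring_nf
  rw [this]
  exact pow_smul_mem (hys x hx) _

/-- The maps `m ↦ m / (x₁ ⋯ xₙ) ^ t` into top local cohomology. -/
structure TopMaps (xs : List R) (M : Type) [AddCommGroup M] [Module R M]
    (c : ℕ → M →ₗ[R] LC (Ideal.ofList xs) xs.length M) : Prop where
  mem_of_eq_zero : ∀ t b, c t b = 0 → ∃ s, xs.prod ^ s • b ∈ powSubmodule xs (t + s) M
  pow_smul : ∀ t, ∀ x ∈ xs, ∀ b, c t (x ^ t • b) = 0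
  succ : ∀ t b, c (t + 1) (xs.prod • b) = c t b
  exists_eq : ∀ a, ∃ t b, c t b = a

namespace TopMaps

variable {xs : List R} {c : ℕ → M →ₗ[R] LC (Ideal.ofList xs) xs.length M}

lemma apply_add (h : TopMaps xs M c) (t s : ℕ) (b : M) : c (t + s) (xs.prod ^ s • b) = c t b := by
  induction s with
  | zero => simp
  | succ s ih => rw [← add_assoc, pow_succ', mul_smul, h.succ, ih]

lemma exists_linearMap (h : TopMaps xs M c) {E : Type} [AddCommGroup E] [Module R E]
    (e : ℕ → M →ₗ[R] E) (hpow : ∀ t, ∀ x ∈ xs, ∀ b, e t (x ^ t • b) = 0)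
    (hsucc : ∀ t b, e (t + 1) (xs.prod • b) = e t b) :
    ∃ l : LC (Ideal.ofList xs) xs.length M →ₗ[R] E, ∀ t b, l (c t b) = e t b := by
  have hadd : ∀ t s b, e (t + s) (xs.prod ^ s • b) = e t b := by
    intro t s b
    induction s with
    | zero => simp
    | succ s ih => rw [← add_assoc, pow_succ', mul_smul, hsucc, ih]
  let S : Submodule R (LC (Ideal.ofList xs) xs.length M × E) :=
    { carrier := { p | ∃ t b, c t b = p.1 ∧ e t b = p.2 }
      zero_mem' := ⟨0, 0, map_zero _, map_zero _⟩
      add_mem' := by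
        rintro p p' ⟨t, b, h1, h2⟩ ⟨t', b', h1', h2'⟩
        refine ⟨t + t', xs.prod ^ t' • b + xs.prod ^ t • b', ?_, ?_⟩
        · rw [map_add, h.apply_add, add_comm t, h.apply_add, h1, h1', Prod.fst_add]
        · rw [map_add, hadd, add_comm t, hadd, h2, h2', Prod.snd_add]
      smul_mem' := by
        rintro r p ⟨t, b, h1, h2⟩
        exact ⟨t, r • b, by rw [map_smul, h1, Prod.smul_fst], by rw [map_smul, h2, Prod.smul_snd]⟩ }
  obtain ⟨l, hl⟩ := exists_linearMap_of_relation S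
    (fun a ↦ by
      obtain ⟨t, b, rfl⟩ := h.exists_eq a
      exact ⟨_, t, b, rfl, rfl⟩)
    (by
      rintro c' ⟨t, b, h1, h2⟩
      obtain ⟨s, hs⟩ := h.mem_of_eq_zero t b h1
      have hle : powSubmodule xs (t + s) M ≤ LinearMap.ker (e (t + s)) :=
        powSubmodule_le fun x hx m ↦ hpow _ x hx m
      refine h2.symm.trans ?_
      rw [← hadd t s b]
      exact hle hs)
  exact ⟨l, fun t b ↦ hl _ _ ⟨t, b, rfl, rfl⟩⟩

end TopMaps

lemma exists_topMaps [IsNoetherianRing R] (xs : List R) (M : Type) [AddCommGroup M] [Module R M] :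
    ∃ c, TopMaps xs M c := by
  induction xs with
  | nil =>
    have hbij : Function.Bijective (ev (Ideal.ofList ([] : List R)) M) := by
      refine ⟨ev_injective, fun m ↦ exists_ev_eq (t := 1) fun r hr ↦ ?_⟩
      rw [Ideal.ofList_nil, pow_one] at hr
      rw [Ideal.mem_bot.1 hr, zero_smul]
    let c : M →ₗ[R] LC (Ideal.ofList ([] : List R)) 0 M :=
      (LinearEquiv.ofBijective _ hbij).symm.toLinearMap
    have hc : ∀ b, ev _ M (c b) = b := (LinearEquiv.ofBijective _ hbij).apply_symm_apply
    refine ⟨fun _ ↦ c, ⟨?_, ?_, ?_, ?_⟩⟩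
    · intro t b hb
      refine ⟨0, ?_⟩
      rw [← hc b]
      rw [hb, map_zero, smul_zero]
      exact Submodule.zero_mem _
    · simp
    · simp
    · exact fun a ↦ ⟨0, ev _ M a, ev_injective (hc _)⟩
  | cons x xs ih =>
    obtain ⟨c, hc⟩ := ih
    obtain ⟨κ, hκ⟩ := exists_connecting (ofList_le_cons x xs) (ofList_cons_eq x xs) xs.length M
    refine ⟨fun t ↦ κ t ∘ₗ c t, ⟨?_, ?_, ?_, ?_⟩⟩
    · intro t b hb
      obtain ⟨s, e', he'⟩ := (hκ.eq_zero_iff _ _).1 hb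
      obtain ⟨u, b', rfl⟩ := hc.exists_eq e'
      have h1 : c (t + u) (xs.prod ^ u • x ^ s • b - x ^ (t + s) • xs.prod ^ t • b') = 0 := by
        rw [map_sub, hc.apply_add, map_smul, map_smul, add_comm t u, hc.apply_add, he', sub_self]
      obtain ⟨r, hr⟩ := hc.mem_of_eq_zero _ _ h1
      refine ⟨r + u + s, ?_⟩
      have h2 := Submodule.smul_mem _ (x ^ (r + u)) (prod_pow_smul_mem (s := s)
        (fun y hy ↦ List.mem_cons_of_mem x hy) hr)
      have h3 := pow_smul_mem (n := t + (r + u + s)) (xs := x :: xs) List.mem_cons_self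
        ((xs.prod ^ s * xs.prod ^ r * xs.prod ^ t) • b')
      have h4 : t + u + r + s = t + (r + u + s) := by lia
      rw [h4] at h2
      convert Submodule.add_mem _ h2 h3 using 1
      rw [List.prod_cons]
      simp only [smul_sub, smul_smul]
      rw [sub_add_eq_add_sub, eq_sub_iff_add_eq]
      congr 2 <;> ring
    · intro t y hy b
      rcases List.mem_cons.1 hy with rfl | hy
      · refine (hκ.eq_zero_iff _ _).2 ⟨0, c t b, ?_⟩
        rw [pow_zero, one_smul, map_smul, add_zero]
      · rw [LinearMap.comp_apply, hc.pow_smul t y hy, map_zero]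
    · intro t b
      rw [List.prod_cons, LinearMap.comp_apply, LinearMap.comp_apply, mul_smul, map_smul,
        hc.succ, hκ.succ]
    · intro a
      obtain ⟨k, e, rfl⟩ := (hκ.res_eq_zero_iff a).1 (eq_zero_of_length_lt xs (by lia) _)
      obtain ⟨u, b, rfl⟩ := hc.exists_eq e
      have hadd : ∀ s e, κ (k + s) (x ^ s • e) = κ k e := by
        intro s e
        induction s with
        | zero => simp
        | succ s ih => rw [← add_assoc, pow_succ', mul_smul, hκ.succ, ih]
      refine ⟨k + u, (xs.prod ^ k • x ^ u • b), ?_⟩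
      rw [LinearMap.comp_apply, add_comm k, hc.apply_add, map_smul, add_comm u, hadd]

end list
end LC

lemma isArtinian_of_ker_lsmul {R W : Type} [CommRing R] [AddCommGroup W] [Module R W] (x : R)
    (hx : ∀ w : W, ∃ k : ℕ, x ^ k • w = 0) [IsArtinian R (LinearMap.ker (LinearMap.lsmul R W x))] :
    IsArtinian R W := by
  set K := LinearMap.ker (LinearMap.lsmul R W x)
  refine monotone_stabilizes_iff_artinian.1 fun f ↦ ?_
  let F : ℕ → Submodule R W := fun i ↦ OrderDual.ofDual (f i)
  have hF : ∀ {i j}, i ≤ j → F j ≤ F i := fun h ↦ f.monotone h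
  let A : ℕ → ℕ → Submodule R K := fun i k ↦
    ((F i).map (LinearMap.lsmul R W (x ^ k))).comap K.subtype
  have hA : ∀ {i j k l}, i ≤ j → k ≤ l → A j l ≤ A i k := by
    intro i j k l hij hkl u hu
    obtain ⟨w, hw, hwu⟩ := hu
    refine ⟨x ^ (l - k) • w, (F i).smul_mem _ (hF hij hw), ?_⟩
    rw [← hwu]
    simp only [LinearMap.lsmul_apply, smul_smul, ← pow_add]
    congr 2
    lia
  obtain ⟨_, ⟨⟨i₀, k₀⟩, rfl⟩, hmin⟩ := IsArtinian.set_has_minimal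
    (Set.range fun p : ℕ × ℕ ↦ A p.1 p.2) ⟨_, (0, 0), rfl⟩
  have hrow : ∀ k, ∃ N, ∀ i, N ≤ i → A N k = A i k := fun k ↦
    IsArtinian.monotone_stabilizes
      ⟨fun i ↦ OrderDual.toDual (A i k), fun i j h ↦ hA h le_rfl⟩
  choose N hN using hrow
  let n := max i₀ ((Finset.range k₀).sup N)
  have hstab : ∀ i, n ≤ i → ∀ k, A n k = A i k := by
    intro i hi k
    by_cases hk : k < k₀
    · have h1 : N k ≤ n := (Finset.le_sup (f := N) (Finset.mem_range.2 hk)).trans (le_max_right _ _)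
      rw [← hN k n h1, ← hN k i (h1.trans hi)]
    · have key : ∀ j, n ≤ j → A j k = A i₀ k₀ := fun j hj ↦
        (hA ((le_max_left _ _).trans hj) (not_lt.1 hk)).eq_of_not_lt (hmin _ ⟨(j, k), rfl⟩)
      rw [key n le_rfl, key i hi]
  refine ⟨n, fun i hi ↦ ?_⟩
  change F n = F i
  refine le_antisymm (fun w hw ↦ ?_) (hF hi)
  obtain ⟨e, he⟩ := hx w
  induction e generalizing w with
  | zero =>
    rw [pow_zero, one_smul] at he
    rw [he]
    exact zero_mem _
  | succ e ih =>
    have hK : x ^ e • w ∈ K := by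
      change x • x ^ e • w = 0
      rwa [smul_smul, ← pow_succ']
    have hmem : (⟨x ^ e • w, hK⟩ : K) ∈ A n e := ⟨w, hw, rfl⟩
    rw [hstab i hi e] at hmem
    obtain ⟨w', hw', h⟩ := hmem
    have := ih (w - w') ((F n).sub_mem hw (hF hi hw')) (by
      rw [smul_sub, sub_eq_zero]
      exact h.symm)
    simpa using (F i).add_mem this hw'

/-- A class of modules that contains the middle term of an exact sequence along with the outer ones,
and which can be tested on the kernel of a locally nilpotent multiplication. -/
structure IsTestable (R : Type) [CommRing R]
    (S : ∀ (W : Type) [AddCommGroup W] [Module R W], Prop) : Prop where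
  of_subsingleton : ∀ (W : Type) [AddCommGroup W] [Module R W] [Subsingleton W], S W
  of_exact : ∀ {A B C : Type} [AddCommGroup A] [Module R A] [AddCommGroup B] [Module R B]
    [AddCommGroup C] [Module R C] (f : A →ₗ[R] B) (g : B →ₗ[R] C), Function.Exact f g →
    S A → S C → S B
  of_ker : ∀ {W : Type} [AddCommGroup W] [Module R W] (x : R),
    (∀ w : W, ∃ k : ℕ, x ^ k • w = 0) → S (LinearMap.ker (LinearMap.lsmul R W x)) → S W

lemma isTestable_isArtinian (R : Type) [CommRing R] :
    IsTestable R (fun W _ _ ↦ IsArtinian R W) where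
  of_subsingleton _ _ _ _ := inferInstance
  of_exact f g h _ _ := isArtinian_of_range_eq_ker f g h.linearMap_ker_eq.symm
  of_ker x hx _ := isArtinian_of_ker_lsmul x hx

lemma isTestable_subsingleton (R : Type) [CommRing R] :
    IsTestable R (fun W _ _ ↦ Subsingleton W) where
  of_subsingleton _ _ _ h := h
  of_exact f g h hA hC := by
    refine subsingleton_of_forall_eq 0 fun b ↦ ?_
    obtain ⟨a, rfl⟩ := (h b).1 (Subsingleton.elim _ _)
    rw [Subsingleton.elim a 0, map_zero]
  of_ker {W} _ _ x hx h := by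
    have hinj : ∀ w : W, x • w = 0 → w = 0 := fun w hw ↦
      congrArg Subtype.val (Subsingleton.elim
        (⟨w, hw⟩ : LinearMap.ker (LinearMap.lsmul R W x)) 0)
    refine subsingleton_of_forall_eq 0 fun w ↦ ?_
    obtain ⟨k, hk⟩ := hx w
    induction k with
    | zero => simpa using hk
    | succ k ih => exact ih (hinj _ (by rwa [smul_smul, ← pow_succ']))

namespace IsTestable

variable {R : Type} [CommRing R] {S : ∀ (W : Type) [AddCommGroup W] [Module R W], Prop}
  (hS : IsTestable R S)

include hS

lemma of_injective {A B : Type} [AddCommGroup A] [Module R A] [AddCommGroup B] [Module R B]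
    (f : A →ₗ[R] B) (hf : Function.Injective f) (hB : S B) : S A :=
  hS.of_exact (0 : (⊥ : Submodule R A) →ₗ[R] A) f
    (fun a ↦ ⟨fun h ↦ ⟨0, (hf (h.trans (map_zero f).symm)).symm⟩, by
      rintro ⟨b, rfl⟩
      simp⟩) (hS.of_subsingleton _) hB

lemma of_surjective {A B : Type} [AddCommGroup A] [Module R A] [AddCommGroup B] [Module R B]
    (f : A →ₗ[R] B) (hf : Function.Surjective f) (hA : S A) : S B :=
  hS.of_exact f (0 : B →ₗ[R] (⊥ : Submodule R B))
    (fun b ↦ ⟨fun _ ↦ hf b, fun _ ↦ rfl⟩) hA (hS.of_subsingleton _)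

open LC in
lemma devissage [IsNoetherianRing R] (I : Ideal R) (j : ℕ) (J : Ideal R)
    (h : ∀ Q : Ideal R, Q.IsPrime → J ≤ Q → S (LC I j (R ⧸ Q)))
    (N : Type) [AddCommGroup N] [Module R N] [Module.Finite R N]
    (hN : ∀ r ∈ J, ∀ n : N, r • n = 0) : S (LC I j N) := by
  induction ‹Module.Finite R N› using
    IsNoetherianRing.induction_on_isQuotientEquivQuotientPrime R with
  | subsingleton N =>
    have : Subsingleton (LC I j N) := subsingleton_of_forall_eq 0 fun a ↦ by
      rw [← one_smul R a, ← map_smul_id, Subsingleton.elim ((1 : R) • LinearMap.id : N →ₗ[R] N) 0,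
        map_zero_hom]
    exact hS.of_subsingleton _
  | quotient N q e =>
    have hJ : J ≤ q.asIdeal := fun r hr ↦ by
      have h0 := hN r hr (e.symm 1)
      rw [← map_smul, EmbeddingLike.map_eq_zero_iff] at h0
      rw [← Ideal.Quotient.eq_zero_iff_mem, ← h0, Algebra.smul_def, mul_one]
      rfl
    refine hS.of_injective (map I j e.toLinearMap) (fun a b hab ↦ ?_) (h _ q.2 hJ)
    have h1 := congrArg (map I j e.symm.toLinearMap) hab
    have hc : e.symm.toLinearMap ∘ₗ e.toLinearMap = (1 : R) • LinearMap.id := by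
      ext; simp
    rwa [map_map, map_map, hc, map_smul_id, map_smul_id, one_smul, one_smul] at h1
  | exact N₁ N₂ N₃ f g hf hg hfg h₁ h₃ =>
    refine hS.of_exact _ _ (exact_map_map (SES.mk hf hfg hg) I j)
      (h₁ fun r hr n ↦ hf ?_)
      (h₃ fun r hr n ↦ ?_)
    · rw [map_smul, hN r hr, map_zero]
    · obtain ⟨m, rfl⟩ := hg n
      rw [← map_smul, hN r hr, map_zero]

end IsTestable

namespace LC

section systemOfParameters

variable {R : Type} [CommRing R]

/-- The short exact sequence `0 → R ⧸ Q → R ⧸ Q → R ⧸ (Q + (r)) → 0`, for `r` outside the prime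
`Q`. -/
lemma ses_quotient (Q : Ideal R) [Q.IsPrime] {r : R} (hr : r ∉ Q) :
    SES (r • (LinearMap.id : (R ⧸ Q) →ₗ[R] R ⧸ Q))
      (Submodule.factor (le_sup_left : Q ≤ Q ⊔ Ideal.span {r})) where
  inj := by
    refine (injective_iff_map_eq_zero _).2 fun a ha ↦ ?_
    obtain ⟨a, rfl⟩ := Ideal.Quotient.mk_surjective a
    have h : Ideal.Quotient.mk Q (r * a) = 0 := ha
    rw [Ideal.Quotient.eq_zero_iff_mem] at h ⊢
    exact (Ideal.IsPrime.mem_or_mem ‹_› h).resolve_left hr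
  exact := by
    intro a
    obtain ⟨a, rfl⟩ := Ideal.Quotient.mk_surjective a
    constructor
    · intro h
      have h : Ideal.Quotient.mk (Q ⊔ Ideal.span {r}) a = 0 := h
      rw [Ideal.Quotient.eq_zero_iff_mem] at h
      obtain ⟨q, hq, s, hs, rfl⟩ := Submodule.mem_sup.1 h
      obtain ⟨s, rfl⟩ := Ideal.mem_span_singleton'.1 hs
      refine ⟨Ideal.Quotient.mk Q s, ?_⟩
      change Ideal.Quotient.mk Q (r * s) = _
      rw [map_add, Ideal.Quotient.eq_zero_iff_mem.2 hq, zero_add, mul_comm]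
    · rintro ⟨b, hb⟩
      obtain ⟨b, rfl⟩ := Ideal.Quotient.mk_surjective b
      rw [← hb]
      change Ideal.Quotient.mk (Q ⊔ Ideal.span {r}) (r * b) = 0
      rw [Ideal.Quotient.eq_zero_iff_mem]
      exact Ideal.mul_mem_right _ _ (Ideal.mem_sup_right (Ideal.mem_span_singleton_self r))
  surj := Submodule.factor_surjective _

variable [IsLocalRing R]

/-- The list `z` generates an ideal that is primary to the maximal ideal
modulo `p`. -/
def IsPrimaryMod (p : Ideal R) (z : List R) : Prop :=
  (p ⊔ Ideal.ofList z).radical = maximalIdeal R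

namespace IsPrimaryMod

variable {p : Ideal R} {z : List R} (hz : IsPrimaryMod p z)

include hz

lemma mem_maximalIdeal {x : R} (hx : x ∈ z) : x ∈ maximalIdeal R := by
  rw [← hz]
  exact Ideal.le_radical (Ideal.mem_sup_right (Ideal.subset_span hx))

lemma exists_pow_smul {N : Type} [AddCommGroup N] [Module R N] (hN : ∀ r ∈ p, ∀ n : N, r • n = 0)
    {r : R} (hr : r ∈ maximalIdeal R) {j : ℕ} (a : LC (Ideal.ofList z) j N) :
    ∃ k : ℕ, r ^ k • a = 0 := by
  rw [← hz] at hr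
  obtain ⟨k, hk⟩ := hr
  obtain ⟨s, hs, t, ht, hst⟩ := Submodule.mem_sup.1 hk
  have hsa : ∀ a : LC (Ideal.ofList z) j N, s • a = 0 := fun a ↦ by
    have h0 : s • (LinearMap.id : N →ₗ[R] N) = 0 := LinearMap.ext (hN s hs)
    rw [← map_smul_id, h0, map_zero_hom]
  obtain ⟨l, hl⟩ := LC.exists_pow_smul a ht
  refine ⟨k * l, ?_⟩
  have hsub : r ^ (k * l) - t ^ l ∈ Ideal.span {s} := by
    rw [pow_mul, Ideal.mem_span_singleton, ← hst]
    exact (dvd_of_eq (by ring)).trans (sub_dvd_pow_sub_pow (s + t) t l)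
  obtain ⟨c, hc⟩ := Ideal.mem_span_singleton'.1 hsub
  rw [← sub_add_cancel (r ^ (k * l)) (t ^ l), add_smul, hl, ← hc, mul_smul, hsa, smul_zero,
    add_zero]

lemma exists_pow_smul_quotient {Q : Ideal R} (hQ : p ≤ Q) {r : R} (hr : r ∈ maximalIdeal R) {j : ℕ}
    (a : LC (Ideal.ofList z) j (R ⧸ Q)) : ∃ k : ℕ, r ^ k • a = 0 := by
  refine hz.exists_pow_smul (fun s hs n ↦ ?_) hr a
  obtain ⟨n, rfl⟩ := Ideal.Quotient.mk_surjective n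
  exact Ideal.Quotient.eq_zero_iff_mem.2 (Q.mul_mem_right n (hQ hs))

lemma subsingleton_maximalIdeal [IsNoetherianRing R] (j : ℕ) :
    Subsingleton (LC (Ideal.ofList z) (j + 1) (R ⧸ maximalIdeal R)) :=
  subsingleton_of_forall_eq 0 fun a ↦ eq_zero_of_locally_nilpotent z (fun x hx m ↦ ⟨1, by
    obtain ⟨m, rfl⟩ := Ideal.Quotient.mk_surjective m
    rw [pow_one]
    exact Ideal.Quotient.eq_zero_iff_mem.2
      (Ideal.mul_mem_right m _ (hz.mem_maximalIdeal hx))⟩) a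

lemma nontrivial_maximalIdeal : Nontrivial (LC (Ideal.ofList z) 0 (R ⧸ maximalIdeal R)) := by
  obtain ⟨a, ha⟩ := exists_ev_eq (I := Ideal.ofList z) (t := 1)
    (m := (1 : R ⧸ maximalIdeal R)) (fun r hr ↦ by
    rw [pow_one] at hr
    rw [Algebra.smul_def, mul_one]
    refine Ideal.Quotient.eq_zero_iff_mem.2 ?_
    rw [← hz]
    exact Ideal.le_radical (Ideal.mem_sup_right hr))
  refine ⟨a, 0, fun h ↦ one_ne_zero (α := R ⧸ maximalIdeal R) ?_⟩
  rw [← ha, h, map_zero]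

lemma subsingleton_zero {Q : Ideal R} [Q.IsPrime] (hQ : p ≤ Q) (hne : Q ≠ maximalIdeal R) :
    Subsingleton (LC (Ideal.ofList z) 0 (R ⧸ Q)) := by
  obtain ⟨r, hr, hrQ⟩ := Set.not_subset.1 (fun h : maximalIdeal R ≤ Q ↦
    hne ((le_maximalIdeal_of_isPrime Q).antisymm h))
  refine subsingleton_of_forall_eq 0 fun a ↦ ev_injective ?_
  obtain ⟨k, hk⟩ := hz.exists_pow_smul_quotient hQ hr a
  have h := congrArg (ev _ _) hk
  rw [map_smul, map_zero] at h
  rw [map_zero]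
  generalize ev _ _ a = b at h
  obtain ⟨b, rfl⟩ := Ideal.Quotient.mk_surjective b
  have h : Ideal.Quotient.mk Q (r ^ k * b) = 0 := h
  rw [Ideal.Quotient.eq_zero_iff_mem] at h ⊢
  exact (Ideal.IsPrime.mem_or_mem ‹_› h).resolve_left
    fun h ↦ hrQ (Ideal.IsPrime.mem_of_pow_mem ‹_› _ h)

lemma induction_step [IsNoetherianRing R]
    {S : ∀ (W : Type) [AddCommGroup W] [Module R W], Prop} (hS : IsTestable R S)
    {Q : Ideal R} [Q.IsPrime] (hQ : p ≤ Q) {r : R} (hr : r ∈ maximalIdeal R) (hrQ : r ∉ Q) {j : ℕ}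
    (h : ∀ Q' : Ideal R, Q'.IsPrime → Q < Q' → S (LC (Ideal.ofList z) j (R ⧸ Q'))) :
    S (LC (Ideal.ofList z) (j + 1) (R ⧸ Q)) := by
  have hses := ses_quotient Q hrQ
  have h0 := hS.devissage (Ideal.ofList z) j (Q ⊔ Ideal.span {r})
    (fun Q' hQ' hle ↦ h Q' hQ' (lt_of_le_of_ne (le_sup_left.trans hle) (by
      rintro rfl
      exact hrQ (hle (Ideal.mem_sup_right (Ideal.mem_span_singleton_self r))))))
    (R ⧸ (Q ⊔ Ideal.span {r})) (fun s hs n ↦ by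
      obtain ⟨n, rfl⟩ := Ideal.Quotient.mk_surjective n
      exact Ideal.Quotient.eq_zero_iff_mem.2 (Ideal.mul_mem_right n _ hs))
  refine hS.of_ker r (hz.exists_pow_smul_quotient hQ hr) ?_
  have hδ := exact_δ_map hses (Ideal.ofList z) j
  refine hS.of_surjective (LinearMap.codRestrict _ (δ hses (Ideal.ofList z) j) fun a ↦ ?_) ?_ h0
  · change r • δ hses _ j a = 0
    rw [← map_smul_id]
    exact (hδ _).2 ⟨a, rfl⟩
  · rintro ⟨b, hb⟩
    obtain ⟨a, ha⟩ := (hδ b).1 ((map_smul_id r b).trans hb)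
    exact ⟨a, Subtype.ext ha⟩

lemma isArtinian [IsNoetherianRing R] (Q : Ideal R) (hQ : Q.IsPrime) (hpQ : p ≤ Q) (j : ℕ) :
    IsArtinian R (LC (Ideal.ofList z) j (R ⧸ Q)) := by
  induction Q using IsNoetherian.induction generalizing j with
  | hgt Q ih =>
    by_cases hne : Q = maximalIdeal R
    · subst hne
      cases j with
      | zero =>
        have : IsSimpleModule R (R ⧸ maximalIdeal R) :=
          isSimpleModule_iff_isCoatom.2 (maximalIdeal.isMaximal R).out
        exact isArtinian_of_injective _ (ev_injective (I := Ideal.ofList z))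
      | succ j =>
        have := hz.subsingleton_maximalIdeal j
        infer_instance
    · cases j with
      | zero =>
        have := hz.subsingleton_zero hpQ hne
        infer_instance
      | succ j =>
        obtain ⟨r, hr, hrQ⟩ := Set.not_subset.1 (fun h : maximalIdeal R ≤ Q ↦
          hne ((le_maximalIdeal_of_isPrime Q).antisymm h))
        exact hz.induction_step (isTestable_isArtinian R) hpQ hr hrQ
          fun Q' hQ' hlt ↦ ih Q' hlt hQ' (hpQ.trans hlt.le) j

end IsPrimaryMod
end systemOfParameters
end LC

section avoid

variable {R : Type} [CommRing R] [IsNoetherianRing R]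

open Order

lemma lt_coheight_of_lt {α : Type*} [Preorder α] {a b : α} (h : a < b) {n : ℕ}
    (ha : coheight a ≤ n) : coheight b < n :=
  coheight_le_coe_iff.1 ha b h

lemma coheight_head_one {α : Type*} [Preorder α] (p : LTSeries α) {n : ℕ} (hn : p.length = n + 1) :
    p.head < p 1 ∧ n ≤ coheight (p 1) := by
  obtain ⟨l, f, hf⟩ := p
  obtain rfl : l = n + 1 := hn
  refine ⟨hf 0, ?_⟩
  simpa [Fin.rev] using rev_index_le_coheight (⟨n + 1, f, hf⟩ : LTSeries α) (1 : Fin (n + 2))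

lemma one_lt_last {α : Type*} [Preorder α] (p : LTSeries α) {n : ℕ} (hn : p.length = n + 2) :
    p 1 < p.last := by
  obtain ⟨l, f, hf⟩ := p
  obtain rfl : l = n + 2 := hn
  exact LTSeries.strictMono ⟨n + 2, f, hf⟩ (by simp [Fin.lt_def])

lemma exists_lt_coheight_eq_notMem {P : PrimeSpectrum R} {n : ℕ} (hP : coheight P = (n + 2 : ℕ))
    {b : R} (hb : b ∉ P.asIdeal) :
    ∃ Q : PrimeSpectrum R, P < Q ∧ coheight Q = (n + 1 : ℕ) ∧ b ∉ Q.asIdeal := by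
  suffices h : ∃ Q : PrimeSpectrum R, P < Q ∧ (n + 1 : ℕ) ≤ coheight Q ∧ b ∉ Q.asIdeal by
    obtain ⟨Q, h1, h2, h3⟩ := h
    refine ⟨Q, h1, le_antisymm ?_ h2, h3⟩
    have := lt_coheight_of_lt h1 hP.le
    exact ENat.lt_natCast_add_one_iff.1 this
  obtain ⟨s, hs, hlen⟩ := exists_series_of_coheight_eq_coe P hP
  by_cases hbs : b ∈ s.last.asIdeal
  swap
  · obtain ⟨h1, h2⟩ := coheight_head_one s hlen
    exact ⟨s 1, hs ▸ h1, h2, fun h ↦ hbs (s.monotone (Fin.le_last 1) h)⟩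
  have hlast : ∀ q ∈ (P.asIdeal ⊔ Ideal.span {b}).minimalPrimes, ¬ s.last.asIdeal ≤ q := by
    intro q hq hle
    obtain ⟨r, hbr, hrlen, hrhead, hrlast⟩ :=
      PrimeSpectrum.exist_ltSeries_mem_one_of_mem_last s hbs
    have h1 := (coheight_head_one r (hrlen.symm.trans hlen)).1
    have h2 : r 1 < r.last := one_lt_last r (hrlen.symm.trans hlen)
    have h3 : P.asIdeal ⊔ Ideal.span {b} ≤ (r 1).asIdeal := by
      refine sup_le ?_ ((Ideal.span_singleton_le_iff_mem _).2 hbr)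
      rw [← hs, hrhead]
      exact h1.le
    have h4 : r.last.asIdeal ≤ q := hrlast ▸ hle
    exact h2.not_ge (h4.trans (hq.2 ⟨(r 1).2, h3⟩ ((show (r 1).asIdeal ≤ _ from h2.le).trans h4)))
  obtain ⟨c, hc, hcq⟩ : ∃ c ∈ s.last.asIdeal,
      ∀ q ∈ (P.asIdeal ⊔ Ideal.span {b}).minimalPrimes, c ∉ q := by
    have hfin := Ideal.finite_minimalPrimes_of_isNoetherianRing R (P.asIdeal ⊔ Ideal.span {b})
    have : ¬ (s.last.asIdeal : Set R) ⊆ ⋃ q ∈ (hfin.toFinset : Set (Ideal R)), (q : Set R) := by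
      rw [Ideal.subset_union_prime ⊥ ⊥ (fun q hq _ _ ↦ (hfin.mem_toFinset.1 hq).1.1)]
      rintro ⟨q, hq, hle⟩
      exact hlast q (hfin.mem_toFinset.1 hq) hle
    obtain ⟨c, hc, hcq⟩ := Set.not_subset.1 this
    exact ⟨c, hc, fun q hq h ↦ hcq (by simpa using ⟨q, hq, h⟩)⟩
  obtain ⟨r, hcr, hrlen, hrhead, -⟩ := PrimeSpectrum.exist_ltSeries_mem_one_of_mem_last s hc
  obtain ⟨h1, h2⟩ := coheight_head_one r (hrlen.symm.trans hlen)
  rw [← hrhead, hs] at h1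
  refine ⟨r 1, h1, h2, fun hbr ↦ ?_⟩
  obtain ⟨q, hq, hqr⟩ := Ideal.exists_minimalPrimes_le
    (sup_le h1.le ((Ideal.span_singleton_le_iff_mem _).2 hbr) :
      P.asIdeal ⊔ Ideal.span {b} ≤ (r 1).asIdeal)
  let q' : PrimeSpectrum R := ⟨q, hq.1.1⟩
  have hPq : P < q' := lt_of_le_of_ne (le_sup_left.trans hq.1.2) (by
    intro h
    rw [h] at hb
    exact hb (hq.1.2 (Ideal.mem_sup_right (Ideal.mem_span_singleton_self b))))
  have hqr' : q' < r 1 := lt_of_le_of_ne hqr (by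
    intro h
    exact hcq q hq (by rwa [← h] at hcr))
  have h3 : coheight (r 1) < (n + 1 : ℕ) :=
    lt_coheight_of_lt hqr' (ENat.lt_natCast_add_one_iff.1 (lt_coheight_of_lt hPq hP.le))
  exact h3.not_ge h2

end avoid

namespace LC
section systemOfParameters

open Order

variable {R : Type} [CommRing R]

lemma smul_eq_zero_quotient {I : Ideal R} (Q : Ideal R) {c : R} (hc : c ∈ Q) {j : ℕ}
    (a : LC I j (R ⧸ Q)) : c • a = 0 := by
  have h0 : c • (LinearMap.id : (R ⧸ Q) →ₗ[R] R ⧸ Q) = 0 := by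
    ext
    exact Ideal.Quotient.eq_zero_iff_mem.2 (Q.mul_mem_right 1 hc)
  rw [← map_smul_id, h0, map_zero_hom]

variable [IsLocalRing R] [IsNoetherianRing R]

namespace IsPrimaryMod

variable {p : Ideal R} {z : List R} (hz : IsPrimaryMod p z)

include hz

lemma subsingleton_of_coheight_lt (Q : PrimeSpectrum R) (hpQ : p ≤ Q.asIdeal) {j : ℕ}
    (hj : coheight Q < j) : Subsingleton (LC (Ideal.ofList z) j (R ⧸ Q.asIdeal)) := by
  induction j generalizing Q with
  | zero => simp at hj
  | succ j ih =>
    by_cases hne : Q.asIdeal = maximalIdeal R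
    · rw [hne]
      exact hz.subsingleton_maximalIdeal j
    · obtain ⟨r, hr, hrQ⟩ := Set.not_subset.1 (fun h : maximalIdeal R ≤ Q.asIdeal ↦
        hne ((le_maximalIdeal_of_isPrime Q.asIdeal).antisymm h))
      refine hz.induction_step (isTestable_subsingleton R) hpQ hr hrQ fun Q' hQ' hlt ↦
        ih ⟨Q', hQ'⟩ (hpQ.trans hlt.le) ?_
      exact lt_coheight_of_lt (a := Q) hlt (ENat.lt_natCast_add_one_iff.1 hj)

lemma smul_surjective (Q : PrimeSpectrum R) (hpQ : p ≤ Q.asIdeal) {j : ℕ} (hj : coheight Q ≤ j)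
    {b : R} (hb : b ∉ Q.asIdeal) (a : LC (Ideal.ofList z) j (R ⧸ Q.asIdeal)) :
    ∃ a', b • a' = a := by
  have hses := ses_quotient Q.asIdeal hb
  have h0 := (isTestable_subsingleton R).devissage (Ideal.ofList z) j
    (Q.asIdeal ⊔ Ideal.span {b})
    (fun Q' hQ' hle ↦ hz.subsingleton_of_coheight_lt ⟨Q', hQ'⟩ (hpQ.trans (le_sup_left.trans hle))
      (lt_coheight_of_lt (a := Q) (lt_of_le_of_ne (le_sup_left.trans hle) (by
        rintro rfl
        exact hb (hle (Ideal.mem_sup_right (Ideal.mem_span_singleton_self b))))) hj))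
    (R ⧸ (Q.asIdeal ⊔ Ideal.span {b})) (fun s hs n ↦ by
      obtain ⟨n, rfl⟩ := Ideal.Quotient.mk_surjective n
      exact Ideal.Quotient.eq_zero_iff_mem.2 (Ideal.mul_mem_right n _ hs))
  obtain ⟨a', ha'⟩ := (exact_map_map hses (Ideal.ofList z) j a).1 (Subsingleton.elim _ _)
  exact ⟨a', by rwa [map_smul_id] at ha'⟩

lemma map_factor_surjective {P Q : PrimeSpectrum R} (hpP : p ≤ P.asIdeal) {n : ℕ}
    (hP : coheight P ≤ (n + 1 : ℕ))
    (h : Subsingleton (LC (Ideal.ofList z) (n + 1) (R ⧸ P.asIdeal))) (hPQ : P ≤ Q) :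
    Function.Surjective (map (Ideal.ofList z) n
      (Submodule.factor (show P.asIdeal ≤ Q.asIdeal from hPQ))) := by
  have hses : SES (LinearMap.ker (Submodule.factor (show P.asIdeal ≤ Q.asIdeal from hPQ))).subtype
      (Submodule.factor (show P.asIdeal ≤ Q.asIdeal from hPQ)) :=
    ⟨Subtype.val_injective, LinearMap.exact_subtype_ker_map _, Submodule.factor_surjective _⟩
  have h0 := (isTestable_subsingleton R).devissage (Ideal.ofList z) (n + 1) P.asIdeal
    (fun Q' hQ' hle ↦ by
      by_cases he : P.asIdeal = Q'
      · rwa [← he]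
      · exact hz.subsingleton_of_coheight_lt ⟨Q', hQ'⟩ (hpP.trans hle)
          (lt_coheight_of_lt (a := P) (lt_of_le_of_ne hle fun h ↦ he (by rw [h])) hP))
    (LinearMap.ker (Submodule.factor (show P.asIdeal ≤ Q.asIdeal from hPQ))) (fun s hs n ↦ by
      obtain ⟨n, hn⟩ := n
      refine Subtype.ext ?_
      obtain ⟨n, rfl⟩ := Ideal.Quotient.mk_surjective n
      exact Ideal.Quotient.eq_zero_iff_mem.2 (Ideal.mul_mem_right n _ hs))
  exact fun a ↦ (exact_map_δ hses (Ideal.ofList z) n a).1 (Subsingleton.elim _ _)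

theorem nontrivial_of_coheight_eq (P : PrimeSpectrum R) (hpP : p ≤ P.asIdeal) {n : ℕ}
    (hn : coheight P = n) : Nontrivial (LC (Ideal.ofList z) n (R ⧸ P.asIdeal)) := by
  induction n generalizing P with
  | zero =>
    have hmax : P = closedPoint R :=
      (coheight_eq_zero.1 hn).eq_of_le (le_maximalIdeal_of_isPrime P.asIdeal)
    rw [hmax]
    exact hz.nontrivial_maximalIdeal
  | succ n ih =>
    by_contra hcon
    rw [not_nontrivial_iff_subsingleton] at hcon
    have hsurj := fun Q hPQ ↦ hz.map_factor_surjective (Q := Q) hpP hn.le hcon hPQ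
    have hne : P.asIdeal ≠ maximalIdeal R := by
      intro h
      have : coheight P = 0 := coheight_eq_zero.2 fun Q _ ↦ by
        change Q.asIdeal ≤ P.asIdeal
        rw [h]
        exact le_maximalIdeal_of_isPrime _
      rw [this] at hn
      exact absurd hn (by norm_cast)
    cases n with
    | zero =>
      have h0 := hz.subsingleton_zero hpP hne
      have := hz.nontrivial_maximalIdeal
      obtain ⟨a, ha⟩ := exists_ne (0 : LC (Ideal.ofList z) 0 (R ⧸ maximalIdeal R))
      obtain ⟨b, rfl⟩ := hsurj (closedPoint R) (le_maximalIdeal_of_isPrime P.asIdeal) a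
      exact ha (by rw [Subsingleton.elim b 0]; exact map_zero _)
    | succ n =>
      have := hz.isArtinian P.asIdeal P.2 hpP (n + 1)
      obtain ⟨_, ⟨⟨b, hb⟩, rfl⟩, hmin⟩ := IsArtinian.set_has_minimal
        (Set.range fun b : {b : R // b ∉ P.asIdeal} ↦ LinearMap.range
          (LinearMap.lsmul R (LC (Ideal.ofList z) (n + 1) (R ⧸ P.asIdeal)) b.1))
        ⟨_, ⟨1, fun h ↦ P.2.ne_top ((Ideal.eq_top_iff_one _).2 h)⟩, rfl⟩
      obtain ⟨Q, hPQ, hQn, hbQ⟩ := exists_lt_coheight_eq_notMem hn hb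
      obtain ⟨c, hcQ, hcP⟩ := Set.not_subset.1 hPQ.not_ge
      have hpQ : p ≤ Q.asIdeal := hpP.trans hPQ.le
      have := ih Q hpQ hQn
      obtain ⟨a, ha⟩ := exists_ne (0 : LC (Ideal.ofList z) (n + 1) (R ⧸ Q.asIdeal))
      obtain ⟨a, rfl⟩ := hz.smul_surjective Q hpQ hQn.le hbQ a
      obtain ⟨w, rfl⟩ := hsurj Q hPQ.le a
      have hle : LinearMap.range (LinearMap.lsmul R
          (LC (Ideal.ofList z) (n + 1) (R ⧸ P.asIdeal)) (b * c)) ≤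
          LinearMap.range (LinearMap.lsmul R (LC (Ideal.ofList z) (n + 1) (R ⧸ P.asIdeal)) b) := by
        rintro _ ⟨w, rfl⟩
        exact ⟨c • w, (mul_smul b c w).symm⟩
      have heq := hle.eq_of_not_lt (hmin _ ⟨⟨b * c, fun h ↦
        (P.2.mem_or_mem h).elim hb hcP⟩, rfl⟩)
      obtain ⟨w', hw'⟩ : b • w ∈ LinearMap.range (LinearMap.lsmul R
          (LC (Ideal.ofList z) (n + 1) (R ⧸ P.asIdeal)) (b * c)) := heq ▸ ⟨w, rfl⟩
      refine ha ?_
      rw [← map_smul, ← hw', LinearMap.lsmul_apply, mul_comm, mul_smul, map_smul]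
      exact smul_eq_zero_quotient Q.asIdeal hcQ _

end IsPrimaryMod
end systemOfParameters
end LC

section functional

variable {R : Type} [CommRing R] {E : Type} [AddCommGroup E] [Module R E]

/-- A sequence of elements killed by `p` that defines a functional on the top local cohomology of
`R ⧸ p` with support in the ideal generated by a list, with annihilator `p`. -/
structure DualSystem (p : Ideal R) (xs : List R) (ε : ℕ → E) : Prop where
  smul_eq_zero : ∀ r ∈ p, ∀ t, r • ε t = 0
  pow_smul : ∀ x ∈ xs, ∀ t, x ^ t • ε t = 0
  prod_smul : ∀ t, xs.prod • ε (t + 1) = ε t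
  exists_smul_ne_zero : ∀ b ∉ p, ∃ t, b • ε t ≠ 0

/-- A two-index version of `DualSystem` for a concatenation of two lists. -/
structure BiDualSystem (p : Ideal R) (xs ys : List R) (θ : ℕ → ℕ → E) : Prop where
  smul_eq_zero : ∀ r ∈ p, ∀ s d, r • θ s d = 0
  pow_smul_left : ∀ x ∈ xs, ∀ s d, x ^ s • θ s d = 0
  pow_smul_right : ∀ y ∈ ys, ∀ s d, y ^ d • θ s d = 0
  prod_smul_left : ∀ s d, xs.prod • θ (s + 1) d = θ s d
  prod_smul_right : ∀ s d, ys.prod • θ s (d + 1) = θ s d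
  exists_smul_ne_zero : ∀ b ∉ p, ∃ s d, b • θ s d ≠ 0

lemma DualSystem.biDualSystem {p : Ideal R} {xs ys : List R} {θ : ℕ → E}
    (h : DualSystem p (xs ++ ys) θ) :
    BiDualSystem p xs ys (fun s d ↦ (xs.prod ^ d * ys.prod ^ s) • θ (s + d)) := by
  have hprod : ∀ t, (xs.prod * ys.prod) • θ (t + 1) = θ t := fun t ↦ by
    rw [← List.prod_append, h.prod_smul]
  have hpow : ∀ t, (xs.prod ^ t * ys.prod ^ t) • θ (t + t) = θ t := by
    suffices H : ∀ k t, (xs.prod ^ k * ys.prod ^ k) • θ (t + k) = θ t from fun t ↦ H t t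
    intro k
    induction k with
    | zero => simp
    | succ k ih =>
      intro t
      rw [← ih t, ← add_assoc, ← hprod (t + k), smul_smul]
      congr 1
      ring
  have hmem : ∀ x ∈ xs ++ ys, ∀ (a : R) (t : ℕ), (x ^ t * a) • θ t = 0 := fun x hx a t ↦ by
    rw [mul_comm, mul_smul, h.pow_smul x hx, smul_zero]
  refine ⟨fun r hr s d ↦ ?_, fun x hx s d ↦ ?_, fun y hy s d ↦ ?_, fun s d ↦ ?_, fun s d ↦ ?_,
    fun b hb ↦ ?_⟩
  · rw [smul_comm, h.smul_eq_zero r hr, smul_zero]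
  · obtain ⟨c, hc⟩ := List.dvd_prod hx
    rw [smul_smul, ← hmem x (List.mem_append_left _ hx) (c ^ d * ys.prod ^ s), hc]
    congr 1
    ring
  · obtain ⟨c, hc⟩ := List.dvd_prod hy
    rw [smul_smul, ← hmem y (List.mem_append_right _ hy) (c ^ s * xs.prod ^ d), hc]
    congr 1
    ring
  · rw [← hprod (s + d), smul_smul, smul_smul, add_right_comm]
    congr 1
    ring
  · rw [← hprod (s + d), smul_smul, smul_smul, add_assoc]
    congr 1
    ring
  · obtain ⟨t, ht⟩ := h.exists_smul_ne_zero b hb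
    exact ⟨t, t, by rwa [hpow]⟩

namespace BiDualSystem

variable {p : Ideal R} {xs ys : List R} {θ : ℕ → ℕ → E} (h : BiDualSystem p xs ys θ)

include h

lemma prod_pow_smul_right (s d k : ℕ) : ys.prod ^ k • θ s (d + k) = θ s d := by
  induction k with
  | zero => simp
  | succ k ih => rw [pow_succ, mul_smul, ← add_assoc, h.prod_smul_right, ih]

lemma zero_left (hxs : xs ≠ []) (d : ℕ) : θ 0 d = 0 := by
  obtain ⟨x, hx⟩ := List.exists_mem_of_ne_nil xs hxs
  simpa using h.pow_smul_left x hx 0 d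

lemma prod_pow_smul_eq_zero (hys : ys ≠ []) {s d k : ℕ} (hk : d ≤ k) :
    ys.prod ^ k • θ s d = 0 := by
  obtain ⟨y, hy⟩ := List.exists_mem_of_ne_nil ys hys
  have h0 : θ s 0 = 0 := by simpa using h.pow_smul_right y hy s 0
  obtain ⟨l, rfl⟩ := Nat.exists_eq_add_of_le hk
  have h1 := h.prod_pow_smul_right s 0 d
  rw [zero_add, h0] at h1
  rw [add_comm, pow_add, mul_smul, h1, smul_zero]

/-- The diagonal sum: a dual system for the first list alone. -/
lemma dualSystem (hxs : xs ≠ []) :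
    DualSystem p xs (fun t ↦ ∑ a ∈ Finset.range t, θ (t - a) (a ^ 2)) := by
  refine ⟨fun r hr t ↦ ?_, fun x hx t ↦ ?_, fun t ↦ ?_, fun b hb ↦ ?_⟩
  · rw [Finset.smul_sum]
    exact Finset.sum_eq_zero fun a _ ↦ h.smul_eq_zero r hr _ _
  · rw [Finset.smul_sum]
    refine Finset.sum_eq_zero fun a ha ↦ ?_
    have ha : a < t := Finset.mem_range.1 ha
    obtain ⟨s, rfl⟩ := Nat.exists_eq_add_of_lt ha
    rw [show a + s + 1 - a = s + 1 by lia, add_assoc, pow_add, mul_smul, h.pow_smul_left x hx,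
      smul_zero]
  · rw [Finset.smul_sum, Finset.sum_range_succ]
    rw [show t + 1 - t = 0 + 1 by lia, h.prod_smul_left, h.zero_left hxs, add_zero]
    refine Finset.sum_congr rfl fun a ha ↦ ?_
    have ha : a < t := Finset.mem_range.1 ha
    rw [show t + 1 - a = t - a + 1 by lia, h.prod_smul_left]
  · classical
    have hex := h.exists_smul_ne_zero b hb
    obtain ⟨d, hd⟩ := Nat.find_spec hex
    have hlt : ∀ s < Nat.find hex, ∀ d, b • θ s d = 0 := fun s hs d ↦ by
      by_contra hne
      exact Nat.find_min hex hs ⟨d, hne⟩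
    generalize Nat.find hex = T at hd hlt
    have hT : T ≠ 0 := by
      rintro rfl
      exact hd (by rw [h.zero_left hxs, smul_zero])
    by_cases hys : ys = []
    · subst hys
      refine ⟨T, ?_⟩
      rw [Finset.smul_sum, Finset.sum_eq_single 0 (fun a ha ha0 ↦ hlt _ (by
        have := Finset.mem_range.1 ha
        lia) _) (fun h0 ↦ absurd (Finset.mem_range.2 (Nat.pos_of_ne_zero hT)) h0)]
      have := h.prod_pow_smul_right T 0 d
      rw [List.prod_nil, one_pow, one_smul, zero_add] at this
      rwa [Nat.sub_zero, zero_pow two_ne_zero, ← this]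
    · refine ⟨T + (d + 1), fun hzero ↦ hd ?_⟩
      have h1 := congrArg (fun e ↦ ys.prod ^ d ^ 2 • e) hzero
      simp only [smul_zero] at h1
      rw [Finset.smul_sum, Finset.smul_sum, Finset.sum_eq_single (d + 1) (fun a ha hne ↦ ?_)
        (fun h0 ↦ absurd (Finset.mem_range.2 (by lia)) h0)] at h1
      · rw [Nat.add_sub_cancel, smul_comm,
          show (d + 1) ^ 2 = d + (d + 1) + d ^ 2 by ring, h.prod_pow_smul_right] at h1
        rw [← h.prod_pow_smul_right T d (d + 1), smul_comm, h1, smul_zero]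
      · rcases lt_or_gt_of_ne hne with hlt' | hgt
        · rw [smul_comm, h.prod_pow_smul_eq_zero hys (Nat.pow_le_pow_left (by lia) 2), smul_zero]
        · have := Finset.mem_range.1 ha
          rw [hlt _ (by lia), smul_zero]

end BiDualSystem

lemma exists_linearMap_ne_zero [IsLocalRing R] [Module.Injective R E]
    {f : ResidueField R →ₗ[R] E} (hf : Function.Injective f) {W : Type} [AddCommGroup W]
    [Module R W] {a : W} (ha : a ≠ 0) : ∃ l : W →ₗ[R] E, l a ≠ 0 := by
  let A := LinearMap.ker (LinearMap.toSpanSingleton R W a)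
  have hA : A ≤ maximalIdeal R := le_maximalIdeal fun h ↦ ha (by
    have : (1 : R) ∈ A := h ▸ trivial
    simpa [A] using this)
  let g : (R ⧸ A) →ₗ[R] E := f ∘ₗ (Submodule.factor hA : (R ⧸ A) →ₗ[R] R ⧸ maximalIdeal R)
  obtain ⟨l, hl⟩ := Module.Injective.out (A.liftQ (LinearMap.toSpanSingleton R W a) le_rfl)
    (LinearMap.ker_eq_bot.1 (Submodule.ker_liftQ_eq_bot _ _ _ le_rfl)) g
  refine ⟨l, fun h0 ↦ one_ne_zero (α := ResidueField R) (hf ?_)⟩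
  have h1 := hl (A.mkQ 1)
  rw [Submodule.mkQ_apply, Submodule.liftQ_apply, LinearMap.toSpanSingleton_apply, one_smul,
    h0] at h1
  rw [map_zero]
  exact h1.symm

open LC

lemma exists_dualSystem [IsLocalRing R] [IsNoetherianRing R] [Module.Injective R E]
    {f : ResidueField R →ₗ[R] E} (hf : Function.Injective f) (p : PrimeSpectrum R) {z : List R}
    (hz : IsPrimaryMod p.asIdeal z) (hlen : Order.coheight p = z.length) :
    ∃ θ : ℕ → E, DualSystem p.asIdeal z θ := by
  have := hz.nontrivial_of_coheight_eq p le_rfl hlen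
  obtain ⟨a₀, ha₀⟩ := exists_ne (0 : LC (Ideal.ofList z) z.length (R ⧸ p.asIdeal))
  obtain ⟨l, hl⟩ := exists_linearMap_ne_zero hf ha₀
  obtain ⟨c, hc⟩ := exists_topMaps z (R ⧸ p.asIdeal)
  refine ⟨fun t ↦ l (c t 1), fun r hr t ↦ ?_, fun x hx t ↦ ?_, fun t ↦ ?_, fun b hb ↦ ?_⟩
  · rw [← map_smul, smul_eq_zero_quotient _ hr, map_zero]
  · rw [← map_smul, ← map_smul, hc.pow_smul t x hx, map_zero]
  · rw [← map_smul, ← map_smul, hc.succ]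
  · obtain ⟨a, rfl⟩ := hz.smul_surjective p le_rfl hlen.le hb a₀
    obtain ⟨t, m, rfl⟩ := hc.exists_eq a
    obtain ⟨r, rfl⟩ := Ideal.Quotient.mk_surjective m
    refine ⟨t, fun h0 ↦ hl ?_⟩
    have hr : Ideal.Quotient.mk p.asIdeal r = r • (1 : R ⧸ p.asIdeal) := by
      rw [Algebra.smul_def, mul_one]
      rfl
    rw [hr, map_smul, map_smul, map_smul, smul_comm, h0, smul_zero]

lemma mem_associatedPrimes_of_dualSystem [IsNoetherianRing R] {p : Ideal R} (hp : p.IsPrime)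
    {xs : List R} {ε : ℕ → E} (h : DualSystem p xs ε) :
    p ∈ associatedPrimes R (LocalCohomologyModule (Ideal.ofList xs) xs.length R →ₗ[R] E) := by
  obtain ⟨c, hc⟩ := exists_topMaps xs (R ⧸ p)
  let e : ℕ → (R ⧸ p) →ₗ[R] E := fun t ↦
    p.liftQ (LinearMap.toSpanSingleton R E (ε t)) fun r hr ↦ h.smul_eq_zero r hr t
  have he : ∀ t r, e t (Ideal.Quotient.mk p r) = r • ε t := fun t r ↦ rfl
  obtain ⟨l, hl⟩ := hc.exists_linearMap e
    (fun t x hx b ↦ by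
      obtain ⟨r, rfl⟩ := Ideal.Quotient.mk_surjective b
      rw [map_smul, he, smul_comm, h.pow_smul x hx, smul_zero])
    (fun t b ↦ by
      obtain ⟨r, rfl⟩ := Ideal.Quotient.mk_surjective b
      rw [map_smul, he, he, smul_comm, h.prod_smul])
  have hses : SES (Submodule.subtype p) (Submodule.mkQ p) :=
    ⟨Subtype.val_injective, LinearMap.exact_subtype_mkQ p, Submodule.mkQ_surjective p⟩
  have hsurj : Function.Surjective (map (Ideal.ofList xs) xs.length (Submodule.mkQ p)) := fun a ↦
    (exact_map_δ hses _ _ a).1 (eq_zero_of_length_lt xs (Nat.lt_succ_self _) _)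
  let Λ : LocalCohomologyModule (Ideal.ofList xs) xs.length R →ₗ[R] E :=
    l ∘ₗ map (Ideal.ofList xs) xs.length (Submodule.mkQ p) ∘ₗ compHom (Ideal.ofList xs) xs.length R
  refine AssociatedPrimes.mem_iff.2 (isAssociatedPrime_iff.2 ⟨hp, Λ, ?_⟩)
  ext r
  rw [Submodule.mem_colon_singleton, Submodule.mem_bot]
  constructor
  · intro hr
    refine LinearMap.ext fun w ↦ ?_
    change r • l _ = 0
    rw [← map_smul, smul_eq_zero_quotient _ hr, map_zero]
  · intro hr
    by_contra hrp
    obtain ⟨t, ht⟩ := h.exists_smul_ne_zero r hrp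
    obtain ⟨w, hw⟩ := hsurj (c t (Ideal.Quotient.mk p 1))
    obtain ⟨w, rfl⟩ := compHom_surjective _ _ _ w
    have h1 : r • l (map (Ideal.ofList xs) xs.length (Submodule.mkQ p)
      (compHom (Ideal.ofList xs) xs.length R w)) = 0 := LinearMap.congr_fun hr w
    rw [hw, hl, he, one_smul] at h1
    exact ht h1

end functional

lemma coheight_eq_of_ringKrullDim_quotient {R : Type} [CommRing R] (p : PrimeSpectrum R) {n : ℕ}
    (h : ringKrullDim (R ⧸ p.asIdeal) = n) : Order.coheight p = n := by
  rw [ringKrullDim_quotient] at h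
  have hset : PrimeSpectrum.zeroLocus (p.asIdeal : Set R) = Set.Ici p := rfl
  rw [hset, ← Order.coheight_eq_krullDim_Ici] at h
  exact_mod_cast h

lemma span_range_eq_ofList {R : Type} [CommRing R] {n : ℕ} (x : Fin n → R) :
    Ideal.span (Set.range x) = Ideal.ofList (List.ofFn x) := by
  congr 1
  ext r
  simp [List.mem_ofFn]

end LocalCoh

/-- Theorem 2.2.1, second inclusion: if `(R,m)` is a noetherian local
equicharacteristic ring, `i ≥ 1` and `x_1,…,x_i ∈ R`, then every prime `p` such that
`x_1,…,x_i` is part of a system of parameters for `R/p` is an associated prime of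
`D(H^i_{(x_1,…,x_i)R}(R))`. -/
theorem stmt8 (R : Type) [CommRing R] [IsLocalRing R] [IsNoetherianRing R]
    (hequichar : ∃ k : Subring R, IsField k)
    (i : ℕ) (hi : 1 ≤ i) (x : Fin i → R)
    (E : Type) [AddCommGroup E] [Module R E] (hE : IsInjectiveHullOfResidueField R E) :
    { p : Ideal R | p.IsPrime ∧ IsPartOfSystemOfParameters p x } ⊆
      associatedPrimes R
        (LocalCohomologyModule (Ideal.span (Set.range x)) i R →ₗ[R] E) := by
  rintro p ⟨hp, n, h, y, hyx, hdim, hrad⟩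
  obtain ⟨hinj, f, hf, -⟩ := hE
  obtain ⟨k, rfl⟩ := Nat.exists_eq_add_of_le h
  have hy : List.ofFn y = List.ofFn x ++ List.ofFn fun j : Fin k ↦ y (Fin.natAdd i j) := by
    rw [List.ofFn_add]
    congr 2
    exact funext hyx
  have hz : LocalCoh.LC.IsPrimaryMod p (List.ofFn y) := by
    rw [LocalCoh.LC.IsPrimaryMod, ← LocalCoh.span_range_eq_ofList]
    exact hrad
  obtain ⟨θ, hθ⟩ := LocalCoh.exists_dualSystem hf ⟨p, hp⟩ hz (by
    rw [List.length_ofFn]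
    exact LocalCoh.coheight_eq_of_ringKrullDim_quotient ⟨p, hp⟩ hdim)
  rw [hy] at hθ
  have hx : List.ofFn x ≠ [] := by
    rw [Ne, List.ofFn_eq_nil_iff]
    lia
  have key := LocalCoh.mem_associatedPrimes_of_dualSystem hp (hθ.biDualSystem.dualSystem hx)
  rwa [← LocalCoh.span_range_eq_ofList, List.length_ofFn] at key
end
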